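/- arXiv:1208.1822 — 3 statements merged into one kernel-verified Lean document; each statement's English description precedes it below -/
import Mathlib

section
/- Let I be a squarefree lexsegment ideal of S = K[x_1,…,x_n], generated by monomials of degree d. Then sdepth_n(I) = d if and only if μ(I) > ξ_{n−d}, where ξ_k = Σ_{j=1}^k C(2j−1, j). -/
noncomputable section

open MvPolynomial

/-- The total degree of an exponent vector. -/
def edeg {n : ℕ} (a : Fin n →₀ ℕ) : ℕ := ∑ i, a i

/-- An exponent vector is squarefree if every exponent is at most 1. -/
def IsSqfree {n : ℕ} (a : Fin n →₀ ℕ) : Prop := ∀ i, a i ≤ 1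

/-- The set of exponent vectors of monomials belonging to the ideal `I`. -/
def expSet {K : Type} [Field K] {n : ℕ} (I : Ideal (MvPolynomial (Fin n) K)) :
    Set (Fin n →₀ ℕ) := {a | (monomial a (1 : K)) ∈ I}

/-- `I` is generated by monomials `x^a` with `a` satisfying the predicate `P`. -/
def GenBy {K : Type} [Field K] {n : ℕ} (I : Ideal (MvPolynomial (Fin n) K))
    (P : (Fin n →₀ ℕ) → Prop) : Prop :=
  ∃ G : Set (Fin n →₀ ℕ), (∀ a ∈ G, P a) ∧
    I = Ideal.span ((fun a => (monomial a (1 : K))) '' G)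

/-- `I` is a monomial ideal. -/
def IsMonomialIdeal {K : Type} [Field K] {n : ℕ} (I : Ideal (MvPolynomial (Fin n) K)) : Prop :=
  GenBy I fun _ => True

/-- `I` is a squarefree monomial ideal. -/
def IsSqfreeMonomialIdeal {K : Type} [Field K] {n : ℕ}
    (I : Ideal (MvPolynomial (Fin n) K)) : Prop := GenBy I IsSqfree

/-- `x^a >_lex x^b` in the lexicographic order with `x_1 > x_2 > ⋯ > x_n`. -/
def lexGT {n : ℕ} (a b : Fin n →₀ ℕ) : Prop :=
  ∃ i : Fin n, (∀ j : Fin n, j < i → a j = b j) ∧ b i < a i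

/-- `I` is a lexsegment ideal. -/
def IsLexsegment {K : Type} [Field K] {n : ℕ} (I : Ideal (MvPolynomial (Fin n) K)) : Prop :=
  IsMonomialIdeal I ∧ ∀ a b : Fin n →₀ ℕ, (monomial a (1 : K)) ∈ I → edeg b = edeg a →
    lexGT b a → (monomial b (1 : K)) ∈ I

/-- `I` is a squarefree lexsegment ideal. -/
def IsSqfreeLexsegment {K : Type} [Field K] {n : ℕ}
    (I : Ideal (MvPolynomial (Fin n) K)) : Prop :=
  IsSqfreeMonomialIdeal I ∧ ∀ a b : Fin n →₀ ℕ, IsSqfree a → IsSqfree b →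
    (monomial a (1 : K)) ∈ I → edeg b = edeg a → lexGT b a → (monomial b (1 : K)) ∈ I

/-- The minimal number of generators of an ideal. -/
def mu {K : Type} [Field K] {n : ℕ} (I : Ideal (MvPolynomial (Fin n) K)) : ℕ :=
  sInf {m | ∃ G : Finset (MvPolynomial (Fin n) K), G.card = m ∧ I = Ideal.span (G : Set _)}

/-- `ξ_k = ∑_{j=1}^k C(2j-1, j)`. -/
def xi (k : ℕ) : ℕ := ∑ j ∈ Finset.Icc 1 k, (2 * j - 1).choose j

/-- The Hilbert function of `I`: the `K`-dimension of the degree-`j` component of `I`. -/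
def hilb {K : Type} [Field K] {n : ℕ} (I : Ideal (MvPolynomial (Fin n) K)) (j : ℕ) : ℕ :=
  Module.finrank K ↥((Submodule.restrictScalars K I) ⊓ homogeneousSubmodule (Fin n) K j)

/-- The Hilbert function of `I` extended to all integer degrees. -/
def hilbZ {K : Type} [Field K] {n : ℕ} (I : Ideal (MvPolynomial (Fin n) K)) (j : ℤ) : ℕ :=
  if 0 ≤ j then hilb I j.toNat else 0

/-- The Hilbert function of a standard graded polynomial ring in `d` variables,
at degree `t ∈ ℤ`. -/
def polyHilb (d : ℕ) (t : ℤ) : ℕ :=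
  if t < 0 then 0 else if d = 0 then (if t = 0 then 1 else 0) else (t.toNat + (d - 1)).choose (d - 1)

/-- A (standard graded) Hilbert decomposition of `I` all of whose retracts are polynomial
rings in at least `k` variables: `I ≅ ⊕ᵢ Sᵢ(-sᵢ)` as graded `K`-vector spaces, where `Sᵢ`
is a graded algebra retract of `S`, i.e. a polynomial ring in `dd i ≥ k` variables. -/
def HilbertDecomp1 {K : Type} [Field K] {n : ℕ} (I : Ideal (MvPolynomial (Fin n) K))
    (k : ℕ) : Prop :=
  ∃ (ι : Type) (_ : Fintype ι) (dd : ι → ℕ) (s : ι → ℤ),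
    (∀ i, k ≤ dd i) ∧ ∀ j : ℤ, hilbZ I j = ∑ i, polyHilb (dd i) (j - s i)

/-- The Hilbert depth of `I` in the standard graded sense. -/
def hdepth1 {K : Type} [Field K] {n : ℕ} (I : Ideal (MvPolynomial (Fin n) K)) : ℕ∞ :=
  sSup {k : ℕ∞ | ∃ m : ℕ, HilbertDecomp1 I m ∧ k = m}

/-- The set of exponent vectors `u + ℕ^Z`, corresponding to the Stanley space `x^u K[Z]`. -/
def cone {n : ℕ} (u : Fin n →₀ ℕ) (Z : Finset (Fin n)) : Set (Fin n →₀ ℕ) :=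
  {a | (∀ j, u j ≤ a j) ∧ ∀ j ∉ Z, a j = u j}

/-- A Stanley decomposition, with all Stanley spaces of dimension at least `k`, of the
`ℤⁿ`-graded module whose monomial basis has exponent set `A`. -/
def StanleyPartN {n : ℕ} (A : Set (Fin n →₀ ℕ)) (k : ℕ) : Prop :=
  ∃ (ι : Type) (_ : Fintype ι) (u : ι → (Fin n →₀ ℕ)) (Z : ι → Finset (Fin n)),
    (∀ i, k ≤ (Z i).card) ∧ (∀ i, cone (u i) (Z i) ⊆ A) ∧
    (∀ a ∈ A, ∃! i, a ∈ cone (u i) (Z i))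

/-- The multigraded Stanley depth of the `ℤⁿ`-graded module whose monomial basis has
exponent set `A`. -/
def sdepthN {n : ℕ} (A : Set (Fin n →₀ ℕ)) : ℕ∞ :=
  sSup {k : ℕ∞ | ∃ m : ℕ, StanleyPartN A m ∧ k = m}

/-- A multigraded Hilbert decomposition of the monomial ideal `I`, with all retracts
polynomial rings in at least `k` variables: the multigraded Hilbert function of `I`
(which takes values 0 and 1) equals the sum of the multigraded Hilbert functions of
the shifted retracts `x^{u i} K[Z i]`. -/
def HilbertDecompN {K : Type} [Field K] {n : ℕ} (I : Ideal (MvPolynomial (Fin n) K))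
    (k : ℕ) : Prop :=
  ∃ (ι : Type) (_ : Fintype ι) (u : ι → (Fin n →₀ ℕ)) (Z : ι → Finset (Fin n)),
    (∀ i, k ≤ (Z i).card) ∧
    (∀ a : Fin n →₀ ℕ, (a ∈ expSet I ↔ ∃ i, a ∈ cone (u i) (Z i)) ∧
      (∀ i i', a ∈ cone (u i) (Z i) → a ∈ cone (u i') (Z i') → i = i'))

/-- The multigraded Hilbert depth of a monomial ideal `I`. -/
def hdepthN {K : Type} [Field K] {n : ℕ} (I : Ideal (MvPolynomial (Fin n) K)) : ℕ∞ :=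
  sSup {k : ℕ∞ | ∃ m : ℕ, HilbertDecompN I m ∧ k = m}

/-- The graded maximal ideal `(x_1, …, x_n)`. -/
def maxIdeal (K : Type) [Field K] (n : ℕ) : Ideal (MvPolynomial (Fin n) K) :=
  Ideal.span (Set.range X)

/-- The depth of a module `M` over `S = K[x_1,…,x_n]` with respect to the graded maximal
ideal: the supremum of lengths of `M`-regular sequences in `(x_1,…,x_n)`. -/
def mdepth (K : Type) [Field K] (n : ℕ) (M : Type)
    [AddCommGroup M] [Module (MvPolynomial (Fin n) K) M] : ℕ∞ :=
  sSup {k : ℕ∞ | ∃ rs : List (MvPolynomial (Fin n) K),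
    (∀ r ∈ rs, r ∈ maxIdeal K n) ∧ RingTheory.Sequence.IsRegular M rs ∧ k = rs.length}

/-- The quotient module `I/J` for ideals `J ≤ I`. -/
def quotMod {K : Type} [Field K] {n : ℕ} (I J : Ideal (MvPolynomial (Fin n) K)) : Type :=
  ↥I ⧸ (Submodule.comap (Submodule.subtype I) J)

instance {K : Type} [Field K] {n : ℕ} (I J : Ideal (MvPolynomial (Fin n) K)) :
    AddCommGroup (quotMod I J) := by unfold quotMod; infer_instance

instance {K : Type} [Field K] {n : ℕ} (I J : Ideal (MvPolynomial (Fin n) K)) :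
    Module (MvPolynomial (Fin n) K) (quotMod I J) := by unfold quotMod; infer_instance

/-- `ρ_j(I\J)`: the number of squarefree monomials of degree `j` in `I ∖ J`. -/
def rho {K : Type} [Field K] {n : ℕ} (I J : Ideal (MvPolynomial (Fin n) K)) (j : ℕ) : ℕ :=
  Set.ncard {a : Fin n →₀ ℕ | IsSqfree a ∧ edeg a = j ∧ a ∈ expSet I ∧ a ∉ expSet J}

/-- `ρ_j(I)`: the number of squarefree monomials of degree `j` in `I`. -/
def rhoI {K : Type} [Field K] {n : ℕ} (I : Ideal (MvPolynomial (Fin n) K)) (j : ℕ) : ℕ :=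
  Set.ncard {a : Fin n →₀ ℕ | IsSqfree a ∧ edeg a = j ∧ a ∈ expSet I}

/-- `I` is a stable monomial ideal. Here `j` plays the role of `m(u)`, the largest index of
a variable dividing `u = x^a`. -/
def IsStable {K : Type} [Field K] {n : ℕ} (I : Ideal (MvPolynomial (Fin n) K)) : Prop :=
  IsMonomialIdeal I ∧ ∀ a : Fin n →₀ ℕ, (monomial a (1 : K)) ∈ I →
    ∀ j : Fin n, a j ≠ 0 → (∀ l, j < l → a l = 0) → ∀ i, i < j →
      (monomial (a + Finsupp.single i 1 - Finsupp.single j 1) (1 : K)) ∈ I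

/-- `I` is a squarefree stable monomial ideal. -/
def IsSqfreeStable {K : Type} [Field K] {n : ℕ} (I : Ideal (MvPolynomial (Fin n) K)) : Prop :=
  IsSqfreeMonomialIdeal I ∧ ∀ a : Fin n →₀ ℕ, IsSqfree a → (monomial a (1 : K)) ∈ I →
    ∀ j : Fin n, a j ≠ 0 → (∀ l, j < l → a l = 0) → ∀ i, i < j → a i = 0 →
      (monomial (a + Finsupp.single i 1 - Finsupp.single j 1) (1 : K)) ∈ I

/-- `I` is a squarefree strongly stable monomial ideal. -/
def IsSqfreeStronglyStable {K : Type} [Field K] {n : ℕ}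
    (I : Ideal (MvPolynomial (Fin n) K)) : Prop :=
  IsSqfreeMonomialIdeal I ∧ ∀ a : Fin n →₀ ℕ, IsSqfree a → (monomial a (1 : K)) ∈ I →
    ∀ i : Fin n, a i ≠ 0 → ∀ j, j < i → a j = 0 →
      (monomial (a + Finsupp.single j 1 - Finsupp.single i 1) (1 : K)) ∈ I

/-- The exponent vectors of the minimal monomial generators of a monomial ideal:
the monomials of `I` minimal with respect to divisibility. -/
def minGens {K : Type} [Field K] {n : ℕ} (I : Ideal (MvPolynomial (Fin n) K)) :
    Set (Fin n →₀ ℕ) := {a | a ∈ expSet I ∧ ∀ b ∈ expSet I, b ≤ a → b = a}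

/-- `m(u)`: the largest index (1-based) of a variable dividing `x^a`; `0` if `a = 0`. -/
def mvar {n : ℕ} (a : Fin n →₀ ℕ) : ℕ := a.support.sup (fun i => (i : ℕ) + 1)

/-- `m(I) = max { m(u) : u ∈ G(I) }`. -/
def mIdeal {K : Type} [Field K] {n : ℕ} (I : Ideal (MvPolynomial (Fin n) K)) : ℕ :=
  sSup {m | ∃ a ∈ minGens I, m = mvar a}

open MvPolynomial

/-- The `K`-subspace `Aᵢ·xᵢ` of `S`, where `Aᵢ` is the subalgebra generated by `B`. -/
def stSpace {K : Type} [Field K] {n : ℕ} (B : Finset (MvPolynomial (Fin n) K))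
    (x : MvPolynomial (Fin n) K) : Submodule K (MvPolynomial (Fin n) K) :=
  (Subalgebra.toSubmodule (Algebra.adjoin K (B : Set (MvPolynomial (Fin n) K)))).map
    (LinearMap.mulLeft K x)

/-- A standard graded Stanley decomposition of the ideal `I` with all Stanley spaces of
depth at least `k`: a finite family of graded algebra retracts `Sᵢ = K[Bᵢ]` (generated by
`k ≤ |Bᵢ|` linearly independent linear forms) and homogeneous elements `xᵢ ∈ I` with
`Sᵢ ∩ ann(xᵢ) = 0`, such that `I = ⊕ᵢ Sᵢ xᵢ` as graded `K`-vector spaces. -/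
def StanleyDecomp1 {K : Type} [Field K] {n : ℕ} (I : Ideal (MvPolynomial (Fin n) K))
    (k : ℕ) : Prop :=
  ∃ (ι : Type) (_ : Fintype ι) (B : ι → Finset (MvPolynomial (Fin n) K))
    (x : ι → MvPolynomial (Fin n) K) (d : ι → ℕ),
      (∀ i, ∀ b ∈ B i, b ∈ homogeneousSubmodule (Fin n) K 1) ∧
      (∀ i, LinearIndependent K (fun b : (B i : Set (MvPolynomial (Fin n) K)) =>
        (b : MvPolynomial (Fin n) K))) ∧
      (∀ i, k ≤ (B i).card) ∧
      (∀ i, x i ∈ I) ∧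
      (∀ i, x i ∈ homogeneousSubmodule (Fin n) K (d i)) ∧
      (∀ i, ∀ a ∈ Algebra.adjoin K ((B i : Set (MvPolynomial (Fin n) K))),
        a * x i = 0 → a = 0) ∧
      (iSup (fun i => stSpace (B i) (x i)) = Submodule.restrictScalars K I) ∧
      (iSupIndep fun i => stSpace (B i) (x i))

/-- The standard graded Stanley depth of `I`. -/
def sdepth1 {K : Type} [Field K] {n : ℕ} (I : Ideal (MvPolynomial (Fin n) K)) : ℕ∞ :=
  sSup {k : ℕ∞ | ∃ m : ℕ, StanleyDecomp1 I m ∧ k = m}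

/-- The subspace `S₁ · V` of `S`. -/
def mulS1 {K : Type} [Field K] {n : ℕ} (V : Submodule K (MvPolynomial (Fin n) K)) :
    Submodule K (MvPolynomial (Fin n) K) :=
  Submodule.span K {p | ∃ l ∈ homogeneousSubmodule (Fin n) K 1, ∃ v ∈ V, p = l * v}

/-- A lexsegment set of monomials of degree `d`. -/
def IsLexSet {n : ℕ} (d : ℕ) (L : Set (Fin n →₀ ℕ)) : Prop :=
  (∀ a ∈ L, edeg a = d) ∧ ∀ a ∈ L, ∀ b : Fin n →₀ ℕ, edeg b = d → lexGT b a → b ∈ L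

/-- `V ⊆ S_d` is a Gotzmann space: `dim_K (S₁·V) = dim_K (S₁·lex(V))`, where `lex(V)` is
spanned by the lexsegment set of monomials of degree `d` of cardinality `dim_K V`. -/
def IsGotzmannSpace {K : Type} [Field K] {n : ℕ} (d : ℕ)
    (V : Submodule K (MvPolynomial (Fin n) K)) : Prop :=
  ∃ L : Finset (Fin n →₀ ℕ), IsLexSet (n := n) d (L : Set (Fin n →₀ ℕ)) ∧ L.card = Module.finrank K ↥V ∧
    Module.finrank K ↥(mulS1 V) =
      Module.finrank K ↥(mulS1 (Submodule.span K
        ((fun a => (monomial a (1 : K))) '' (L : Set (Fin n →₀ ℕ)))))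

/-- `I` is a homogeneous ideal in the standard grading. -/
def IsHomogeneousIdeal {K : Type} [Field K] {n : ℕ}
    (I : Ideal (MvPolynomial (Fin n) K)) : Prop :=
  ∀ p ∈ I, ∀ k : ℕ, homogeneousComponent k p ∈ I

/-- `I` is a Gotzmann ideal: each homogeneous component `I_k` is a Gotzmann space. -/
def IsGotzmannIdeal {K : Type} [Field K] {n : ℕ}
    (I : Ideal (MvPolynomial (Fin n) K)) : Prop :=
  IsHomogeneousIdeal I ∧ ∀ k : ℕ,
    IsGotzmannSpace k ((Submodule.restrictScalars K I) ⊓ homogeneousSubmodule (Fin n) K k)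

/-- `I` is generated by homogeneous elements of degree `d`. -/
def GenInDegHomog {K : Type} [Field K] {n : ℕ} (I : Ideal (MvPolynomial (Fin n) K))
    (d : ℕ) : Prop :=
  ∃ G : Set (MvPolynomial (Fin n) K), (∀ g ∈ G, g ∈ homogeneousSubmodule (Fin n) K d) ∧
    I = Ideal.span G

open Finset in
theorem card_le_card_shadow_of_mid {α : Type*} [DecidableEq α] {k : ℕ} {s : Finset α}
    (hs : s.card = 2 * k + 1) {𝒜 : Finset (Finset α)}
    (h𝒜 : 𝒜 ⊆ s.powersetCard (k + 1)) : 𝒜.card ≤ (shadow 𝒜).card := by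
  refine Nat.le_of_mul_le_mul_right
    (card_mul_le_card_mul (fun A B : Finset α => B ⊆ A) (m := k + 1) (n := k + 1) ?_ ?_)
    k.succ_pos
  · intro A hA
    have hAc := (mem_powersetCard.1 (h𝒜 hA)).2
    calc k + 1 = (A.image fun a => A.erase a).card := by
          rw [card_image_of_injOn (erase_injOn A), hAc]
      _ ≤ _ := card_le_card fun B hB => by
          obtain ⟨a, ha, rfl⟩ := mem_image.1 hB
          exact (mem_bipartiteAbove _).2 ⟨erase_mem_shadow hA ha, erase_subset _ _⟩
  · intro B hB
    obtain ⟨A, hA, a, ha, rfl⟩ := mem_shadow_iff.1 hB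
    obtain ⟨hAs, hAc⟩ := mem_powersetCard.1 (h𝒜 hA)
    have hBs : A.erase a ⊆ s := (erase_subset _ _).trans hAs
    have hBc : (A.erase a).card = k := by rw [card_erase_of_mem ha, hAc]; rfl
    calc _ ≤ ((s \ A.erase a).image fun b => insert b (A.erase a)).card := by
          refine card_le_card fun C hC => ?_
          obtain ⟨hC, hsub⟩ := (mem_bipartiteBelow _).1 hC
          obtain ⟨hCs, hCc⟩ := mem_powersetCard.1 (h𝒜 hC)
          obtain ⟨b, hb⟩ : (C \ A.erase a).Nonempty := by
            rw [← card_pos, card_sdiff_of_subset hsub]; omega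
          rw [mem_sdiff] at hb
          refine mem_image.2 ⟨b, mem_sdiff.2 ⟨hCs hb.1, hb.2⟩, ?_⟩
          refine eq_of_subset_of_card_le (insert_subset hb.1 hsub) ?_
          rw [card_insert_of_notMem hb.2]; omega
      _ ≤ (s \ A.erase a).card := card_image_le
      _ = k + 1 := by rw [card_sdiff_of_subset hBs]; omega

/-- The `(k+1)`-subsets of a set with `2k+1` elements can be matched to `k`-subsets. -/
theorem exists_matching_mid {α : Type*} [DecidableEq α] {k : ℕ} {s : Finset α}
    (hs : s.card = 2 * k + 1) :
    ∃ g : Finset α → Finset α, (∀ A ∈ s.powersetCard (k + 1), g A ⊆ A ∧ (g A).card = k) ∧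
      Set.InjOn g (s.powersetCard (k + 1)) := by
  classical
  obtain ⟨f, hf, hfm⟩ := (Finset.all_card_le_biUnion_card_iff_exists_injective
    (fun A : s.powersetCard (k + 1) => Finset.shadow {A.1})).1 fun T => by
      calc T.card = (T.map (Function.Embedding.subtype _)).card := (Finset.card_map _).symm
        _ ≤ _ := card_le_card_shadow_of_mid hs (by intro A; simp; grind)
        _ ≤ _ := Finset.card_le_card fun B hB => by
          obtain ⟨A, hA, a, ha, rfl⟩ := Finset.mem_shadow_iff.1 hB
          obtain ⟨A, hA', rfl⟩ := Finset.mem_map.1 hA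
          exact Finset.mem_biUnion.2
            ⟨A, hA', Finset.erase_mem_shadow (Finset.mem_singleton_self _) ha⟩
  refine ⟨fun A => if h : A ∈ s.powersetCard (k + 1) then f ⟨A, h⟩ else ∅, ?_, ?_⟩
  · intro A hA
    have := hfm ⟨A, hA⟩
    simp only [Finset.mem_shadow_iff, Finset.mem_singleton, exists_eq_left] at this
    obtain ⟨a, ha, h⟩ := this
    simp only [dif_pos hA, ← h]
    refine ⟨Finset.erase_subset _ _, ?_⟩
    rw [Finset.card_erase_of_mem ha, (Finset.mem_powersetCard.1 hA).2]; rfl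
  · intro A hA B hB h
    rw [Finset.mem_coe] at hA hB
    simp only [dif_pos hA, dif_pos hB] at h
    simpa using hf h

/-- `X` precedes `Y` in the colexicographic order. -/
def ColexLT (X Y : Finset ℕ) : Prop := ∃ i ∈ Y, i ∉ X ∧ ∀ j, i < j → (j ∈ X ↔ j ∈ Y)

/-- The set `{1, 3, …, 2m-1}`. -/
def oddSet : ℕ → Finset ℕ
  | 0 => ∅
  | m + 1 => insert (2 * m + 1) (oddSet m)

/-- The `m`-sets that precede `{1, 3, …, 2m-1}` in the colexicographic order. -/
def oddSeg : ℕ → Finset (Finset ℕ)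
  | 0 => ∅
  | m + 1 => (Finset.range (2 * m + 1)).powersetCard (m + 1) ∪
      (oddSeg m).image (insert (2 * m + 1))

/-- The shadow of `oddSeg m`. -/
def oddShadow : ℕ → Finset (Finset ℕ)
  | 0 => ∅
  | m + 1 => (Finset.range (2 * m + 1)).powersetCard m ∪
      (oddShadow m).image (insert (2 * m + 1))

theorem xi_succ (m : ℕ) : xi (m + 1) = xi m + (2 * m + 1).choose (m + 1) := by
  rw [xi, Finset.sum_Icc_succ_top (by omega)]; rfl

theorem subset_card_of_mem_insert_oddSeg {m : ℕ} {A : Finset ℕ}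
    (hA : A ∈ insert (oddSet m) (oddSeg m)) : A ⊆ Finset.range (2 * m) ∧ A.card = m := by
  induction m generalizing A with
  | zero => simp [oddSet, oddSeg] at hA; simp [hA]
  | succ m ih =>
    have key : ∀ B ∈ insert (oddSet m) (oddSeg m),
        insert (2 * m + 1) B ⊆ Finset.range (2 * (m + 1)) ∧
          (insert (2 * m + 1) B).card = m + 1 := fun B hB => by
      obtain ⟨h1, h2⟩ := ih hB
      refine ⟨Finset.insert_subset (by simp; omega)
        (h1.trans (Finset.range_mono (by omega))), ?_⟩
      rw [Finset.card_insert_of_notMem (fun h => by have := h1 h; simp at this), h2]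
    simp only [oddSet, oddSeg, Finset.mem_insert, Finset.mem_union, Finset.mem_powersetCard,
      Finset.mem_image] at hA
    rcases hA with rfl | h | ⟨B, hB, rfl⟩
    · exact key _ (by simp)
    · exact ⟨h.1.trans (Finset.range_mono (by omega)), h.2⟩
    · exact key _ (by simp [hB])

theorem subset_of_mem_oddSeg {m : ℕ} {A : Finset ℕ} (hA : A ∈ oddSeg m) :
    A ⊆ Finset.range (2 * m) :=
  (subset_card_of_mem_insert_oddSeg (Finset.mem_insert_of_mem hA)).1

theorem injOn_insert_oddSeg (m : ℕ) :
    Set.InjOn (insert (2 * m + 1)) (oddSeg m : Set (Finset ℕ)) := by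
  intro A hA B hB h
  have h1 : 2 * m + 1 ∉ A := fun h => by have := subset_of_mem_oddSeg hA h; simp at this
  have h2 : 2 * m + 1 ∉ B := fun h => by have := subset_of_mem_oddSeg hB h; simp at this
  rw [← Finset.erase_insert h1, h, Finset.erase_insert h2]

theorem card_oddSeg (m : ℕ) : (oddSeg m).card = xi m := by
  induction m with
  | zero => rfl
  | succ m ih =>
    rw [oddSeg, Finset.card_union_of_disjoint, Finset.card_powersetCard, Finset.card_range,
      Finset.card_image_of_injOn (injOn_insert_oddSeg m), ih, xi_succ, add_comm]
    rw [Finset.disjoint_left]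
    intro A hA hA'
    obtain ⟨B, -, rfl⟩ := Finset.mem_image.1 hA'
    have := (Finset.mem_powersetCard.1 hA).1 (Finset.mem_insert_self _ _)
    simp at this

theorem card_oddShadow_le (m : ℕ) : (oddShadow m).card ≤ xi m := by
  induction m with
  | zero => rfl
  | succ m ih =>
    refine (Finset.card_union_le _ _).trans ?_
    rw [Finset.card_powersetCard, Finset.card_range, xi_succ, add_comm,
      Nat.choose_symm_half]
    exact Nat.add_le_add_right (Finset.card_image_le.trans ih) _

theorem oddSet_notMem_oddSeg (m : ℕ) : oddSet m ∉ oddSeg m := by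
  induction m with
  | zero => simp [oddSeg]
  | succ m ih =>
    simp only [oddSet, oddSeg, Finset.mem_union, Finset.mem_powersetCard, Finset.mem_image]
    rintro (⟨h, -⟩ | ⟨B, hB, h⟩)
    · have := h (Finset.mem_insert_self _ _)
      simp at this
    · have h1 : 2 * m + 1 ∉ oddSet m := fun h => by
        have := (subset_card_of_mem_insert_oddSeg (Finset.mem_insert_self _ _)).1 h
        simp at this
      have h2 : 2 * m + 1 ∉ B := fun h => by
        have := subset_of_mem_oddSeg hB h
        simp at this
      rw [← Finset.erase_insert h2, h, Finset.erase_insert h1] at hB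
      exact ih hB

theorem mem_oddShadow {m : ℕ} {A B : Finset ℕ} (hA : A ∈ insert (oddSet m) (oddSeg m))
    (hBA : B ⊆ A) (hB : B.card + 1 = m) : B ∈ oddShadow m := by
  induction m generalizing A B with
  | zero => omega
  | succ m ih =>
    have key : ∀ A' ∈ insert (oddSet m) (oddSeg m), B ⊆ insert (2 * m + 1) A' →
        B ∈ oddShadow (m + 1) := fun A' hA' h => by
      obtain ⟨h1, h2⟩ := subset_card_of_mem_insert_oddSeg hA'
      rw [oddShadow, Finset.mem_union]
      by_cases hm : 2 * m + 1 ∈ B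
      · refine Or.inr (Finset.mem_image.2 ⟨B.erase (2 * m + 1), ih hA' ?_ ?_,
          Finset.insert_erase hm⟩)
        · exact Finset.subset_insert_iff.1 h
        · rw [Finset.card_erase_of_mem hm]
          have := Finset.card_pos.2 ⟨_, hm⟩
          omega
      · refine Or.inl (Finset.mem_powersetCard.2 ⟨?_, by omega⟩)
        exact ((Finset.subset_insert_iff_of_notMem hm).1 h).trans
          (h1.trans (Finset.range_mono (by omega)))
    simp only [oddSet, oddSeg, Finset.mem_insert, Finset.mem_union, Finset.mem_powersetCard,
      Finset.mem_image] at hA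
    rcases hA with rfl | h | ⟨A', hA', rfl⟩
    · exact key _ (by simp) hBA
    · exact Finset.mem_union_left _ (Finset.mem_powersetCard.2 ⟨hBA.trans h.1, by omega⟩)
    · exact key _ (by simp [hA']) hBA

/-- The sets in `oddSeg m` can be matched to subsets with one element less. -/
theorem exists_matching_oddSeg (m : ℕ) :
    ∃ g : Finset ℕ → Finset ℕ, (∀ A ∈ oddSeg m, g A ⊆ A ∧ (g A).card + 1 = m) ∧
      Set.InjOn g (oddSeg m) := by
  induction m with
  | zero => exact ⟨id, by simp [oddSeg], by simp [oddSeg]⟩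
  | succ m ih =>
    obtain ⟨g, hg, hgi⟩ := ih
    obtain ⟨f, hf, hfi⟩ := exists_matching_mid (Finset.card_range (2 * m + 1))
    have hsub : ∀ B ∈ oddSeg m, 2 * m + 1 ∉ B := fun B hB h => by
      have := subset_of_mem_oddSeg hB h
      simp at this
    have hout : ∀ B ∈ oddSeg m, 2 * m + 1 ∉ g B := fun B hB h => hsub B hB ((hg B hB).1 h)
    have hfout : ∀ A ∈ (Finset.range (2 * m + 1)).powersetCard (m + 1), 2 * m + 1 ∉ A :=
      fun A hA h => by have := (Finset.mem_powersetCard.1 hA).1 h; simp at this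
    let F : Finset ℕ → Finset ℕ := fun A =>
      if 2 * m + 1 ∈ A then insert (2 * m + 1) (g (A.erase (2 * m + 1))) else f A
    have F1 : ∀ B ∈ oddSeg m, F (insert (2 * m + 1) B) = insert (2 * m + 1) (g B) :=
      fun B hB => by simp [F, Finset.erase_insert (hsub B hB)]
    have F2 : ∀ A ∈ (Finset.range (2 * m + 1)).powersetCard (m + 1), F A = f A :=
      fun A hA => if_neg (hfout A hA)
    have F2out : ∀ A ∈ (Finset.range (2 * m + 1)).powersetCard (m + 1), 2 * m + 1 ∉ F A :=
      fun A hA h => hfout A hA ((hf A hA).1 (F2 A hA ▸ h))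
    refine ⟨F, ?_, ?_⟩
    · intro A hA
      rw [oddSeg, Finset.mem_union, Finset.mem_image] at hA
      rcases hA with hA | ⟨B, hB, rfl⟩
      · rw [F2 A hA]
        exact ⟨(hf A hA).1, by rw [(hf A hA).2]⟩
      · rw [F1 B hB, Finset.card_insert_of_notMem (hout B hB), (hg B hB).2]
        exact ⟨Finset.insert_subset_insert _ (hg B hB).1, rfl⟩
    · intro A hA A' hA' h
      rw [Finset.mem_coe, oddSeg, Finset.mem_union, Finset.mem_image] at hA hA'
      rcases hA with hA | ⟨B, hB, rfl⟩ <;> rcases hA' with hA' | ⟨B', hB', rfl⟩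
      · rw [F2 A hA, F2 A' hA'] at h
        exact hfi hA hA' h
      · rw [F1 B' hB'] at h
        exact absurd (h ▸ Finset.mem_insert_self _ _) (F2out A hA)
      · rw [F1 B hB] at h
        exact absurd (h ▸ Finset.mem_insert_self _ _) (F2out A' hA')
      · rw [F1 B hB, F1 B' hB'] at h
        rw [hgi hB hB' ?_]
        rw [← Finset.erase_insert (hout B hB), h, Finset.erase_insert (hout B' hB')]

theorem eq_or_colexLT_of_notMem_oddSeg {m : ℕ} {X Y : Finset ℕ} (hXc : X.card = m)
    (hX : X ∉ oddSeg m) (hY : Y ∈ insert (oddSet m) (oddSeg m)) : Y = X ∨ ColexLT Y X := by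
  induction m generalizing X Y with
  | zero =>
    simp [oddSet, oddSeg] at hY
    exact Or.inl (by rw [hY, Finset.card_eq_zero.1 hXc])
  | succ m ih =>
    have hYr := (subset_card_of_mem_insert_oddSeg hY).1
    by_cases hXr : X ⊆ Finset.range (2 * (m + 1))
    swap
    · have hne : X.Nonempty := Finset.card_pos.1 (by omega)
      have hmax : 2 * (m + 1) ≤ X.max' hne := by
        obtain ⟨x, hx, hx'⟩ := Finset.not_subset.1 hXr
        have := X.le_max' x hx
        simp at hx'
        omega
      refine Or.inr ⟨X.max' hne, X.max'_mem hne, fun h => ?_, fun j hj => ⟨fun h => ?_,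
        fun h => ?_⟩⟩
      · have := Finset.mem_range.1 (hYr h); omega
      · have := Finset.mem_range.1 (hYr h); omega
      · have := X.le_max' j h; omega
    rw [oddSeg, Finset.mem_union, Finset.mem_image, not_or] at hX
    have hmX : 2 * m + 1 ∈ X := by
      by_contra hm
      refine hX.1 (Finset.mem_powersetCard.2 ⟨fun x hx => ?_, hXc⟩)
      have := hXr hx
      have hne : x ≠ 2 * m + 1 := fun h => hm (h ▸ hx)
      simp at this ⊢
      omega
    have key : ∀ Y' ∈ insert (oddSet m) (oddSeg m), insert (2 * m + 1) Y' = X ∨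
        ColexLT (insert (2 * m + 1) Y') X := fun Y' hY' => by
      rcases ih (X := X.erase (2 * m + 1)) (by rw [Finset.card_erase_of_mem hmX, hXc]; rfl)
        (fun h => hX.2 ⟨_, h, Finset.insert_erase hmX⟩) hY' with h | ⟨i, hi, hi', h⟩
      · exact Or.inl (by rw [h, Finset.insert_erase hmX])
      · rw [Finset.mem_erase] at hi
        refine Or.inr ⟨i, hi.2, by simp [hi.1, hi'], fun j hj => ?_⟩
        rw [Finset.mem_insert, h j hj, Finset.mem_erase]
        by_cases hj' : j = 2 * m + 1
        · simp [hj', hmX]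
        · simp [hj']
    simp only [oddSet, oddSeg, Finset.mem_insert, Finset.mem_union, Finset.mem_powersetCard,
      Finset.mem_image] at hY
    rcases hY with rfl | h | ⟨Y', hY', rfl⟩
    · exact key _ (by simp)
    · refine Or.inr ⟨2 * m + 1, hmX, fun h' => ?_, fun j hj => ⟨fun h' => ?_, fun h' => ?_⟩⟩
      · have := h.1 h'; simp at this
      · have := h.1 h'; simp at this; omega
      · have := hXr h'; simp at this; omega
    · exact key _ (by simp [hY'])

/-- The exponent vector of the squarefree monomial with support `F`. -/
def sqfreeExp {n : ℕ} (F : Finset (Fin n)) : Fin n →₀ ℕ :=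
  Finsupp.equivFunOnFinite.symm fun i => if i ∈ F then 1 else 0

section sqfreeExp

variable {n : ℕ}

@[simp]
theorem sqfreeExp_apply (F : Finset (Fin n)) (i : Fin n) :
    sqfreeExp F i = if i ∈ F then 1 else 0 := rfl

@[simp]
theorem support_sqfreeExp (F : Finset (Fin n)) : (sqfreeExp F).support = F := by
  ext i; simp

theorem isSqfree_sqfreeExp (F : Finset (Fin n)) : IsSqfree (sqfreeExp F) := fun i => by
  rw [sqfreeExp_apply]; split_ifs <;> simp

theorem edeg_sqfreeExp (F : Finset (Fin n)) : edeg (sqfreeExp F) = F.card := by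
  simp [edeg]

theorem IsSqfree.sqfreeExp_support {a : Fin n →₀ ℕ} (ha : IsSqfree a) :
    sqfreeExp a.support = a := by
  ext i
  have := ha i
  by_cases h : a i = 0
  · simp [h]
  · simp [h]; omega

theorem sqfreeExp_le_iff {F : Finset (Fin n)} {a : Fin n →₀ ℕ} :
    sqfreeExp F ≤ a ↔ F ⊆ a.support := by
  refine ⟨fun h i hi => ?_, fun h i => ?_⟩
  · have := h i
    simp [hi] at this
    simp; omega
  · by_cases hi : i ∈ F
    · have := h hi
      simp at this
      simp [hi]; omega
    · simp [hi]

theorem sqfreeExp_injective : Function.Injective (sqfreeExp (n := n)) := fun F F' h => by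
  rw [← support_sqfreeExp F, h, support_sqfreeExp]

theorem mem_cone_sqfreeExp {F Z : Finset (Fin n)} {a : Fin n →₀ ℕ} (hFZ : F ⊆ Z) :
    a ∈ cone (sqfreeExp F) Z ↔ (F ⊆ a.support ∧ a.support ⊆ Z) ∧ ∀ i ∉ Z, a i = 0 := by
  change sqfreeExp F ≤ a ∧ _ ↔ _
  rw [sqfreeExp_le_iff]
  have hz : ∀ j ∉ Z, sqfreeExp F j = 0 := fun j hj => by
    simp only [sqfreeExp_apply, if_neg fun h => hj (hFZ h)]
  constructor
  · rintro ⟨h1, h2⟩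
    have h3 : ∀ j ∉ Z, a j = 0 := fun j hj => (h2 j hj).trans (hz j hj)
    exact ⟨⟨h1, fun j hj => by_contra fun h => Finsupp.mem_support_iff.1 hj (h3 j h)⟩, h3⟩
  · rintro ⟨⟨h1, -⟩, h3⟩
    exact ⟨h1, fun j hj => (h3 j hj).trans (hz j hj).symm⟩

end sqfreeExp

section Generators

variable {K : Type} [Field K] {n d : ℕ} {I : Ideal (MvPolynomial (Fin n) K)}

open Classical in
/-- The supports of the squarefree monomials of degree `d` in `I`. -/
def genSets (I : Ideal (MvPolynomial (Fin n) K)) (d : ℕ) : Finset (Finset (Fin n)) :=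
  {F | F.card = d ∧ sqfreeExp F ∈ expSet I}

theorem mem_genSets {F : Finset (Fin n)} :
    F ∈ genSets I d ↔ F.card = d ∧ sqfreeExp F ∈ expSet I := by
  simp [genSets]

theorem eq_of_mem_genSets_of_subset {F F' : Finset (Fin n)} (hF : F ∈ genSets I d)
    (hF' : F' ∈ genSets I d) (h : F ⊆ F') : F = F' :=
  Finset.eq_of_subset_of_card_le h (by rw [(mem_genSets.1 hF).1, (mem_genSets.1 hF').1])

theorem eq_span_genSets (hgen : GenBy I (fun a => IsSqfree a ∧ edeg a = d)) :
    I = Ideal.span ((fun a => monomial a (1 : K)) ''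
      (sqfreeExp '' (genSets I d : Set (Finset (Fin n))))) := by
  apply le_antisymm
  · obtain ⟨G, hG, hI⟩ := hgen
    conv_lhs => rw [hI]
    refine Ideal.span_mono (Set.image_mono fun a ha => ?_)
    obtain ⟨h1, h2⟩ := hG a ha
    refine ⟨a.support, mem_genSets.2 ⟨?_, ?_⟩, h1.sqfreeExp_support⟩
    · rw [← edeg_sqfreeExp, h1.sqfreeExp_support, h2]
    · rw [h1.sqfreeExp_support]
      change monomial a 1 ∈ I
      rw [hI]
      exact Ideal.subset_span ⟨a, ha, rfl⟩
  · rw [Ideal.span_le]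
    rintro _ ⟨_, ⟨F, hF, rfl⟩, rfl⟩
    exact (mem_genSets.1 hF).2

theorem mem_iff_forall_support (hgen : GenBy I (fun a => IsSqfree a ∧ edeg a = d))
    {p : MvPolynomial (Fin n) K} :
    p ∈ I ↔ ∀ a ∈ p.support, ∃ F ∈ genSets I d, F ⊆ a.support := by
  conv_lhs => rw [eq_span_genSets hgen]
  rw [mem_ideal_span_monomial_image]
  simp [sqfreeExp_le_iff]

theorem mem_expSet_iff (hgen : GenBy I (fun a => IsSqfree a ∧ edeg a = d))
    {a : Fin n →₀ ℕ} : a ∈ expSet I ↔ ∃ F ∈ genSets I d, F ⊆ a.support := by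
  classical
  rw [expSet, Set.mem_ofPred_eq, mem_iff_forall_support hgen, support_monomial,
    if_neg one_ne_zero]
  simp

theorem coeff_mul_sqfreeExp (hgen : GenBy I (fun a => IsSqfree a ∧ edeg a = d))
    {p : MvPolynomial (Fin n) K} (hp : p ∈ I) (q : MvPolynomial (Fin n) K)
    {F : Finset (Fin n)} (hF : F ∈ genSets I d) :
    coeff (sqfreeExp F) (q * p) = coeff 0 q * coeff (sqfreeExp F) p := by
  classical
  rw [coeff_mul, Finset.sum_eq_single (0, sqfreeExp F)]
  · rintro ⟨a, b⟩ hab hne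
    rw [Finset.HasAntidiagonal.mem_antidiagonal] at hab
    by_contra hc
    obtain ⟨F', hF', hsub⟩ := (mem_iff_forall_support hgen).1 hp b
      (mem_support_iff.2 (right_ne_zero_of_mul hc))
    have hb : b ≤ sqfreeExp F := hab ▸ le_add_self
    have hFF : F' ⊆ F := by
      have := sqfreeExp_le_iff.1 ((sqfreeExp_le_iff.2 hsub).trans hb)
      rwa [support_sqfreeExp] at this
    have hb' : b = sqfreeExp F := le_antisymm hb
      (eq_of_mem_genSets_of_subset hF' hF hFF ▸ sqfreeExp_le_iff.2 hsub)
    exact hne (by simpa [hb'] using hab)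
  · simp

theorem mu_eq_card_genSets (hgen : GenBy I (fun a => IsSqfree a ∧ edeg a = d)) :
    mu I = (genSets I d).card := by
  classical
  have hmem : (genSets I d).card ∈ {m | ∃ G : Finset (MvPolynomial (Fin n) K),
      G.card = m ∧ I = Ideal.span (G : Set _)} := by
    refine ⟨(genSets I d).image fun F => monomial (sqfreeExp F) (1 : K), ?_, ?_⟩
    · refine Finset.card_image_of_injective _ fun F F' h => sqfreeExp_injective ?_
      exact monomial_left_injective one_ne_zero h
    · conv_lhs => rw [eq_span_genSets hgen]
      rw [Finset.coe_image, Set.image_image]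
  apply le_antisymm
  · exact Nat.sInf_le hmem
  · refine le_csInf ⟨_, hmem⟩ ?_
    rintro _ ⟨G, rfl, hG⟩
    let φ : MvPolynomial (Fin n) K →ₗ[K] (genSets I d → K) :=
      LinearMap.pi fun F => lcoeff K (sqfreeExp F.1)
    have hφ : ∀ p ∈ I, φ p ∈ Submodule.span K ((G.image φ : Finset _) : Set (genSets I d → K)) := by
      intro p hp
      rw [hG] at hp
      refine Submodule.span_induction (fun x hx => ?_) ?_ (fun x y _ _ hx hy => ?_)
        (fun q x hx hx' => ?_) hp
      · exact Submodule.subset_span (Finset.mem_coe.2 (Finset.mem_image_of_mem _ hx))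
      · rw [map_zero]; exact Submodule.zero_mem _
      · rw [map_add]; exact Submodule.add_mem _ hx hy
      · have : φ (q • x) = coeff 0 q • φ x := funext fun F =>
          coeff_mul_sqfreeExp hgen (hG ▸ hx) q F.2
        rw [this]
        exact Submodule.smul_mem _ _ hx'
    have htop : Submodule.span K ((G.image φ : Finset _) : Set (genSets I d → K)) = ⊤ := by
      rw [eq_top_iff, ← (Pi.basisFun K (genSets I d)).span_eq, Submodule.span_le]
      rintro _ ⟨F, rfl⟩
      have hF : φ (monomial (sqfreeExp F.1) 1) = Pi.basisFun K (genSets I d) F := by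
        ext F'
        have h : φ (monomial (sqfreeExp F.1) 1) F' =
            if sqfreeExp F.1 = sqfreeExp F'.1 then 1 else 0 := coeff_monomial _ _ _
        rw [h, Pi.basisFun_apply, Pi.single_apply]
        exact if_congr (sqfreeExp_injective.eq_iff.trans
          ⟨fun h => Subtype.ext h.symm, fun h => congrArg _ h.symm⟩) rfl rfl
      exact hF ▸ hφ _ (mem_genSets.1 F.2).2
    calc (genSets I d).card = Module.finrank K (genSets I d → K) := by simp
      _ = Set.finrank K ((G.image φ : Finset _) : Set (genSets I d → K)) := by
        rw [Set.finrank, htop, finrank_top]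
      _ ≤ (G.image φ).card := finrank_span_finset_le_card _
      _ ≤ G.card := Finset.card_image_le

end Generators

section Stanley

variable {K : Type} [Field K] {n d : ℕ} {I : Ideal (MvPolynomial (Fin n) K)}

/-- A partition of the supports of the monomials of a squarefree ideal into intervals
yields a Stanley decomposition. -/
theorem stanleyPartN_of_intervals {k : ℕ} {A : Set (Fin n →₀ ℕ)}
    (U : Finset (Fin n) → Prop) (hA : ∀ a, a ∈ A ↔ U a.support)
    (ι : Finset (Fin n) → Prop) (Z : Finset (Fin n) → Finset (Fin n))
    (hZ : ∀ F, ι F → F ⊆ Z F ∧ k ≤ (Z F).card ∧ ∀ H, F ⊆ H → H ⊆ Z F → U H)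
    (hU : ∀ H, U H → ∃! F, ι F ∧ F ⊆ H ∧ H ⊆ Z F) : StanleyPartN A k := by
  classical
  have hmem : ∀ F, ι F → ∀ a, a ∈ cone (sqfreeExp F) (Z F) ↔ F ⊆ a.support ∧ a.support ⊆ Z F :=
    fun F hF a => by
      rw [mem_cone_sqfreeExp (hZ F hF).1, and_iff_left_iff_imp]
      exact fun h i hi => by_contra fun hc => hi (h.2 (Finsupp.mem_support_iff.2 hc))
  refine ⟨{F // ι F}, inferInstance, fun F => sqfreeExp F.1, fun F => Z F.1,
    fun F => (hZ F.1 F.2).2.1, fun F a ha => ?_, fun a ha => ?_⟩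
  · have := (hmem F.1 F.2 a).1 ha
    exact (hA a).2 ((hZ F.1 F.2).2.2 _ this.1 this.2)
  · obtain ⟨F, ⟨hF, h⟩, huniq⟩ := hU _ ((hA a).1 ha)
    refine ⟨⟨F, hF⟩, (hmem F hF a).2 h, fun F' hF' => Subtype.ext ?_⟩
    exact huniq F'.1 ⟨F'.2, (hmem F'.1 F'.2 a).1 hF'⟩

/-- A matching of the generators of degree `d` into squarefree monomials of degree `d+1`. -/
def HasUpMatching (L : Finset (Finset (Fin n))) (d : ℕ) : Prop :=
  ∃ g : Finset (Fin n) → Finset (Fin n), (∀ F ∈ L, F ⊆ g F ∧ (g F).card = d + 1) ∧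
    Set.InjOn g L

theorem stanleyPartN_self (hgen : GenBy I (fun a => IsSqfree a ∧ edeg a = d)) :
    StanleyPartN (expSet I) d := by
  refine stanleyPartN_of_intervals (fun H => ∃ F ∈ genSets I d, F ⊆ H)
    (fun a => mem_expSet_iff hgen) (fun H => ∃ F ∈ genSets I d, F ⊆ H) id ?_ ?_
  · rintro H ⟨F, hF, hFH⟩
    refine ⟨subset_rfl, ?_, fun H' h1 _ => ⟨F, hF, hFH.trans h1⟩⟩
    rw [← (mem_genSets.1 hF).1]
    exact Finset.card_le_card hFH
  · exact fun H hH => ⟨H, ⟨hH, subset_rfl, subset_rfl⟩,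
      fun H' h => Finset.Subset.antisymm h.2.1 h.2.2⟩

theorem stanleyPartN_succ (hgen : GenBy I (fun a => IsSqfree a ∧ edeg a = d))
    (hL : HasUpMatching (genSets I d) d) : StanleyPartN (expSet I) (d + 1) := by
  classical
  obtain ⟨g, hg, hgi⟩ := hL
  have hdich : ∀ F ∈ genSets I d, ∀ H, F ⊆ H → H ⊆ g F → H = F ∨ H = g F := by
    intro F hF H h1 h2
    have := Finset.card_le_card h1
    have h3 := (mem_genSets.1 hF).1
    have h4 := (hg F hF).2
    by_cases h : H.card = d
    · exact Or.inl (Finset.eq_of_subset_of_card_le h1 (by omega)).symm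
    · exact Or.inr (Finset.eq_of_subset_of_card_le h2 (by omega))
  have hgn : ∀ F ∈ genSets I d, g F ∉ genSets I d := fun F hF h => by
    have := (mem_genSets.1 h).1
    have := (hg F hF).2
    omega
  refine stanleyPartN_of_intervals (fun H => ∃ F ∈ genSets I d, F ⊆ H)
    (fun a => mem_expSet_iff hgen)
    (fun H => (∃ F ∈ genSets I d, F ⊆ H) ∧ ∀ F ∈ genSets I d, H ≠ g F)
    (fun H => if H ∈ genSets I d then g H else H) ?_ ?_
  · rintro H ⟨⟨F, hF, hFH⟩, -⟩
    refine ⟨?_, ?_, fun H' h1 _ => ⟨F, hF, hFH.trans h1⟩⟩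
    · split_ifs with h
      · exact (hg H h).1
      · exact subset_rfl
    · split_ifs with h
      · exact (hg H h).2.ge
      · rw [← (mem_genSets.1 hF).1]
        refine Finset.card_lt_card (hFH.ssubset_of_ne ?_)
        rintro rfl
        exact h hF
  · rintro H ⟨F, hF, hFH⟩
    by_cases hH : ∃ F' ∈ genSets I d, H = g F'
    · obtain ⟨F', hF', rfl⟩ := hH
      refine ⟨F', ⟨⟨⟨F', hF', subset_rfl⟩, fun F'' hF'' h => hgn F'' hF'' (h ▸ hF')⟩,
        (hg F' hF').1, by simp [hF']⟩, ?_⟩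
      rintro E ⟨⟨hE, hE'⟩, h1, h2⟩
      split_ifs at h2 with h
      · rcases hdich E h _ h1 h2 with h3 | h3
        · exact absurd (h3 ▸ h) (hgn F' hF')
        · exact (hgi hF' h h3).symm
      · exact absurd (Finset.Subset.antisymm h1 h2) (hE' F' hF')
    · push Not at hH
      refine ⟨H, ⟨⟨⟨F, hF, hFH⟩, hH⟩, subset_rfl, ?_⟩, ?_⟩
      · split_ifs with h
        · exact (hg H h).1
        · exact subset_rfl
      · rintro E ⟨⟨hE, hE'⟩, h1, h2⟩
        split_ifs at h2 with h
        · rcases hdich E h _ h1 h2 with h3 | h3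
          · exact h3.symm
          · exact absurd h3 (hH E h)
        · exact Finset.Subset.antisymm h1 h2

theorem StanleyPartN.hasUpMatching (hgen : GenBy I (fun a => IsSqfree a ∧ edeg a = d))
    {k : ℕ} (hk : d < k) (h : StanleyPartN (expSet I) k) :
    HasUpMatching (genSets I d) d := by
  classical
  obtain ⟨ι, _, u, Z, hZ, hsub, huniq⟩ := h
  have key : ∀ F ∈ genSets I d, ∃ H, F ⊆ H ∧ H.card = d + 1 ∧
      ∃ i, u i = sqfreeExp F ∧ sqfreeExp H ∈ cone (u i) (Z i) := by
    intro F hF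
    obtain ⟨i, hi, -⟩ := huniq _ (mem_genSets.1 hF).2
    obtain ⟨F', hF', h1⟩ := (mem_expSet_iff hgen).1 (hsub i ⟨fun _ => le_rfl, fun _ _ => rfl⟩)
    have hle : u i ≤ sqfreeExp F := hi.1
    have h2 := sqfreeExp_le_iff.2 h1
    have h3 := sqfreeExp_le_iff.1 (h2.trans hle)
    rw [support_sqfreeExp] at h3
    have hFF := eq_of_mem_genSets_of_subset hF' hF h3
    subst hFF
    have hu : u i = sqfreeExp F' := le_antisymm hle h2
    obtain ⟨z, hz, hzF⟩ : ∃ z ∈ Z i, z ∉ F' := Finset.exists_mem_notMem_of_card_lt_card (by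
      rw [(mem_genSets.1 hF).1]; exact hk.trans_le (hZ i))
    refine ⟨insert z F', Finset.subset_insert _ _, ?_, i, hu, fun j => ?_, fun j hj => ?_⟩
    · rw [Finset.card_insert_of_notMem hzF, (mem_genSets.1 hF).1]
    · by_cases hj : j ∈ F' <;> simp [hu, hj]
    · have : j ≠ z := fun h => hj (h ▸ hz)
      simp [hu, this]
  choose! g h1 h2 i h3 h4 using key
  refine ⟨g, fun F hF => ⟨h1 F hF, h2 F hF⟩, fun F hF F' hF' h => sqfreeExp_injective ?_⟩
  rw [← h3 F hF, ← h3 F' hF',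
    (huniq _ (hsub _ (h4 F hF))).unique (h4 F hF) (h ▸ h4 F' hF')]

theorem sdepthN_expSet_eq_iff (hgen : GenBy I (fun a => IsSqfree a ∧ edeg a = d)) :
    sdepthN (expSet I) = (d : ℕ∞) ↔ ¬ HasUpMatching (genSets I d) d := by
  have hle : ∀ m, StanleyPartN (expSet I) m → (m : ℕ∞) ≤ sdepthN (expSet I) :=
    fun m hm => le_sSup ⟨m, hm, rfl⟩
  constructor
  · intro h hL
    have := hle _ (stanleyPartN_succ hgen hL)
    rw [h, Nat.cast_le] at this
    omega
  · intro h
    refine le_antisymm (sSup_le ?_) (hle d (stanleyPartN_self hgen))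
    rintro _ ⟨m, hm, rfl⟩
    rw [Nat.cast_le]
    by_contra hlt
    exact h (hm.hasUpMatching hgen (not_le.1 hlt))

end Stanley

section Complement

variable {n : ℕ}

/-- The reversed complement of a set of variables, as a set of natural numbers. -/
def revCompl (F : Finset (Fin n)) : Finset ℕ := (Fᶜ).image fun i => (i.rev : ℕ)

/-- The inverse of `revCompl`. -/
def revComplInv (n : ℕ) (B : Finset ℕ) : Finset (Fin n) := {i | (i.rev : ℕ) ∉ B}

theorem mem_revCompl_rev {F : Finset (Fin n)} {i : Fin n} :
    (i.rev : ℕ) ∈ revCompl F ↔ i ∉ F := by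
  simp only [revCompl, Finset.mem_image, Finset.mem_compl]
  refine ⟨?_, fun h => ⟨i, h, rfl⟩⟩
  rintro ⟨j, hj, h⟩
  rwa [← Fin.rev_injective (Fin.val_injective h)]

theorem mem_revCompl {F : Finset (Fin n)} {j : ℕ} (hj : j < n) :
    j ∈ revCompl F ↔ Fin.rev ⟨j, hj⟩ ∉ F := by
  rw [← mem_revCompl_rev, Fin.rev_rev]

theorem lt_of_mem_revCompl {F : Finset (Fin n)} {j : ℕ} (hj : j ∈ revCompl F) : j < n := by
  obtain ⟨i, -, rfl⟩ := Finset.mem_image.1 hj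
  exact i.rev.2

theorem card_revCompl (F : Finset (Fin n)) : (revCompl F).card = n - F.card := by
  rw [revCompl, Finset.card_image_of_injective _ fun i j h =>
    Fin.rev_injective (Fin.val_injective h), Finset.card_compl, Fintype.card_fin]

theorem revComplInv_revCompl (F : Finset (Fin n)) : revComplInv n (revCompl F) = F := by
  ext i
  rw [revComplInv, Finset.mem_filter, mem_revCompl_rev, not_not]
  simp

theorem revCompl_injective : Function.Injective (revCompl (n := n)) :=
  Function.LeftInverse.injective revComplInv_revCompl

theorem revCompl_revComplInv {B : Finset ℕ} (hB : ∀ j ∈ B, j < n) :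
    revCompl (revComplInv n B) = B := by
  ext j
  by_cases hj : j < n
  · rw [mem_revCompl hj, revComplInv, Finset.mem_filter, Fin.rev_rev]
    simp
  · exact iff_of_false (fun h => hj (lt_of_mem_revCompl h)) (fun h => hj (hB j h))

theorem revCompl_anti {F F' : Finset (Fin n)} (h : F ⊆ F') : revCompl F' ⊆ revCompl F :=
  Finset.image_subset_image (Finset.compl_subset_compl.2 h)

theorem subset_revComplInv {F : Finset (Fin n)} {B : Finset ℕ} (h : B ⊆ revCompl F) :
    F ⊆ revComplInv n B := fun i hi => by
  rw [revComplInv, Finset.mem_filter]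
  exact ⟨Finset.mem_univ _, fun hB => mem_revCompl_rev.1 (h hB) hi⟩

theorem card_revComplInv {B : Finset ℕ} (hB : ∀ j ∈ B, j < n) :
    (revComplInv n B).card = n - B.card := by
  have h := card_revCompl (revComplInv n B)
  have h' := Finset.card_le_univ (revComplInv n B)
  rw [revCompl_revComplInv hB] at h
  rw [Fintype.card_fin] at h'
  omega

theorem lexGT_sqfreeExp_of_colexLT {F F' : Finset (Fin n)}
    (h : ColexLT (revCompl F) (revCompl F')) : lexGT (sqfreeExp F) (sqfreeExp F') := by
  obtain ⟨j, hj, hj', h⟩ := h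
  have hjn := lt_of_mem_revCompl hj
  rw [mem_revCompl hjn] at hj hj'
  refine ⟨Fin.rev ⟨j, hjn⟩, fun i hi => ?_, ?_⟩
  · have := h i.rev (by rw [← Fin.rev_lt_rev, Fin.rev_rev] at hi; exact hi)
    rw [mem_revCompl_rev, mem_revCompl_rev, not_iff_not] at this
    simp [this]
  · simp [hj, not_not.1 hj']

end Complement

section Lexsegment

variable {K : Type} [Field K] {n d : ℕ} {I : Ideal (MvPolynomial (Fin n) K)}

theorem genSets_lex (hlex : IsSqfreeLexsegment I) :
    (genSets I d).image revCompl ⊆ oddSeg (n - d) ∨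
      insert (oddSet (n - d)) (oddSeg (n - d)) ⊆ (genSets I d).image revCompl := by
  rw [or_iff_not_imp_left, Finset.not_subset]
  rintro ⟨_, hX, hXn⟩ Y hY
  obtain ⟨F, hF, rfl⟩ := Finset.mem_image.1 hX
  obtain ⟨hFc, hFI⟩ := mem_genSets.1 hF
  rcases eq_or_colexLT_of_notMem_oddSeg (by rw [card_revCompl, hFc]) hXn hY with rfl | h
  · exact hX
  · have hYn : ∀ j ∈ Y, j < n := fun j hj => by
      obtain ⟨i, hi, -, h⟩ := h
      have := lt_of_mem_revCompl hi
      rcases lt_or_ge i j with hij | hij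
      · exact lt_of_mem_revCompl ((h j hij).1 hj)
      · omega
    have hd : d ≤ n := by simpa [hFc] using Finset.card_le_univ F
    have hYc : (revComplInv n Y).card = d := by
      rw [card_revComplInv hYn, (subset_card_of_mem_insert_oddSeg hY).2]
      omega
    rw [← revCompl_revComplInv hYn] at h ⊢
    refine Finset.mem_image_of_mem _ (mem_genSets.2 ⟨hYc, ?_⟩)
    exact hlex.2 _ _ (isSqfree_sqfreeExp F) (isSqfree_sqfreeExp _) hFI
      (by rw [edeg_sqfreeExp, edeg_sqfreeExp, hYc, hFc]) (lexGT_sqfreeExp_of_colexLT h)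

theorem hasUpMatching_of_subset_oddSeg
    (h : (genSets I d).image revCompl ⊆ oddSeg (n - d)) : HasUpMatching (genSets I d) d := by
  obtain ⟨f, hf, hfi⟩ := exists_matching_oddSeg (n - d)
  have hmem : ∀ F ∈ genSets I d, revCompl F ∈ oddSeg (n - d) := fun F hF =>
    h (Finset.mem_image_of_mem _ hF)
  have hlt : ∀ F ∈ genSets I d, ∀ j ∈ f (revCompl F), j < n := fun F hF j hj =>
    lt_of_mem_revCompl ((hf _ (hmem F hF)).1 hj)
  refine ⟨fun F => revComplInv n (f (revCompl F)), fun F hF => ⟨?_, ?_⟩, fun F hF F' hF' he => ?_⟩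
  · exact subset_revComplInv (hf _ (hmem F hF)).1
  · rw [card_revComplInv (hlt F hF)]
    have := (hf _ (hmem F hF)).2
    omega
  · apply revCompl_injective
    apply hfi (hmem F hF) (hmem F' hF')
    rw [← revCompl_revComplInv (hlt F hF), ← revCompl_revComplInv (hlt F' hF')]
    exact congrArg revCompl he

theorem not_hasUpMatching_of_insert_subset
    (h : insert (oddSet (n - d)) (oddSeg (n - d)) ⊆ (genSets I d).image revCompl) :
    ¬ HasUpMatching (genSets I d) d := by
  rintro ⟨g, hg, hgi⟩
  have hmem : ∀ A ∈ insert (oddSet (n - d)) (oddSeg (n - d)),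
      revComplInv n A ∈ genSets I d ∧ revCompl (revComplInv n A) = A := fun A hA => by
    obtain ⟨F, hF, rfl⟩ := Finset.mem_image.1 (h hA)
    rw [revComplInv_revCompl]
    exact ⟨hF, rfl⟩
  have hle := Finset.card_le_card_of_injOn
    (s := insert (oddSet (n - d)) (oddSeg (n - d))) (t := oddShadow (n - d))
    (fun A => revCompl (g (revComplInv n A))) (fun A hA => ?_) (fun A hA B hB hAB => ?_)
  · rw [Finset.card_insert_of_notMem (oddSet_notMem_oddSeg _), card_oddSeg] at hle
    have := card_oddShadow_le (n - d)
    omega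
  · obtain ⟨h1, h2⟩ := hmem A hA
    obtain ⟨h3, h4⟩ := hg _ h1
    refine mem_oddShadow hA ?_ ?_
    · conv_rhs => rw [← h2]
      exact revCompl_anti h3
    · have := Finset.card_le_univ (g (revComplInv n A))
      rw [Fintype.card_fin] at this
      rw [card_revCompl]
      omega
  · have := hgi (hmem A hA).1 (hmem B hB).1 (revCompl_injective hAB)
    rw [← (hmem A hA).2, this, (hmem B hB).2]

end Lexsegment

/-- Lemma `sdepth_sqf_lex`. Let `I` be a squarefree lexsegment ideal of
`S = K[x_1,…,x_n]`, generated by monomials of degree `d`. Then `sdepth_n(I) = d` if and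
only if `μ(I) > ξ_{n−d}`. -/
theorem sqfreeLexsegment_sdepthN_eq_iff {K : Type} [Field K] {n d : ℕ}
    (I : Ideal (MvPolynomial (Fin n) K)) (hlex : IsSqfreeLexsegment I)
    (hgen : GenBy I (fun a => IsSqfree a ∧ edeg a = d)) :
    sdepthN (expSet I) = (d : ℕ∞) ↔ xi (n - d) < mu I := by
  rw [sdepthN_expSet_eq_iff hgen, mu_eq_card_genSets hgen]
  have hcard := Finset.card_image_of_injective (genSets I d) revCompl_injective
  rcases genSets_lex (d := d) hlex with h | h
  · have hle := Finset.card_le_card h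
    rw [card_oddSeg, hcard] at hle
    exact iff_of_false (not_not.2 (hasUpMatching_of_subset_oddSeg h)) hle.not_gt
  · have hle := Finset.card_le_card h
    rw [Finset.card_insert_of_notMem (oddSet_notMem_oddSeg _), card_oddSeg, hcard] at hle
    exact iff_of_true (not_hasUpMatching_of_insert_subset h) hle
end
end

section
/- Let I ⊂ S = K[x_1,…,x_n] be a nonzero squarefree stable monomial ideal. Then depth(I) = min{n − m(u) + deg(u) : u ∈ G(I)}. -/
noncomputable section

open MvPolynomial

open MvPolynomial

open CategoryTheory Abelian RingTheory.Sequence in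
/-- `Ext^i(R/𝔪, M) = 0` for all `i < d`. -/
def ExtVanishesBelow {R : Type} [CommRing R] (𝔪 : Ideal R) (M : Type) [AddCommGroup M] [Module R M]
    (d : ℕ) : Prop :=
  ∀ i < d, Subsingleton (Ext (ModuleCat.of R (R ⧸ 𝔪)) (ModuleCat.of R M) i)

namespace ExtVanishesBelow

open CategoryTheory Abelian RingTheory.Sequence

variable {R : Type} [CommRing R] {𝔪 : Ideal R} {M : Type} [AddCommGroup M] [Module R M]

/-- Vanishing passes to a module whose identity factors as a sum through modules with vanishing. -/
theorem of_sum_comp_eq_id {ι : Type} [Fintype ι] {N : ι → ModuleCat.{0} R}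
    (p : ∀ j, M →ₗ[R] N j) (s : ∀ j, N j →ₗ[R] M)
    (h : ∑ j, s j ∘ₗ p j = LinearMap.id) {d : ℕ} (hN : ∀ j, ExtVanishesBelow 𝔪 (N j) d) :
    ExtVanishesBelow 𝔪 M d := by
  intro i hi
  refine subsingleton_of_forall_eq 0 fun x => ?_
  have hid : 𝟙 (ModuleCat.of R M) = ∑ j, ModuleCat.ofHom (p j) ≫ ModuleCat.ofHom (s j) := by
    ext m
    have := LinearMap.congr_fun h m
    simpa [ModuleCat.hom_sum] using this.symm
  rw [← Ext.comp_mk₀_id x, hid, Ext.mk₀_sum, Ext.comp_sum]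
  refine Finset.sum_eq_zero fun j _ => ?_
  have := hN j i hi
  rw [← Ext.mk₀_comp_mk₀, ← Ext.comp_assoc_of_third_deg_zero,
    Subsingleton.elim (x.comp (Ext.mk₀ (ModuleCat.ofHom (p j))) (add_zero i)) 0, Ext.zero_comp]

theorem of_leftInverse {N : Type} [AddCommGroup N] [Module R N] (p : M →ₗ[R] N) (s : N →ₗ[R] M)
    (h : s ∘ₗ p = LinearMap.id) {d : ℕ} (hN : ExtVanishesBelow 𝔪 N d) :
    ExtVanishesBelow 𝔪 M d :=
  of_sum_comp_eq_id (ι := Unit) (N := fun _ => ModuleCat.of R N) (fun _ => p) (fun _ => s) (by simpa using h) fun _ => hN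

theorem congr {N : Type} [AddCommGroup N] [Module R N] (e : M ≃ₗ[R] N) (d : ℕ) :
    ExtVanishesBelow 𝔪 M d ↔ ExtVanishesBelow 𝔪 N d :=
  ⟨of_leftInverse e.symm.toLinearMap e.toLinearMap (by ext; simp),
    of_leftInverse e.toLinearMap e.symm.toLinearMap (by ext; simp)⟩

theorem of_subsingleton [Subsingleton M] (d : ℕ) : ExtVanishesBelow 𝔪 M d :=
  of_sum_comp_eq_id (ι := Empty) (N := fun _ => ModuleCat.of R PUnit) (fun _ => 0) (fun _ => 0)
    (Subsingleton.elim _ _) fun j => j.elim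

theorem zero : ExtVanishesBelow 𝔪 M 0 := fun _ hi => absurd hi (Nat.not_lt_zero _)

/-- Dividing by a regular element of `𝔪` shifts the vanishing of `Ext(R/𝔪, -)` by one. -/
theorem quotSMulTop_iff {x : R} (hx : IsSMulRegular M x) (hx𝔪 : x ∈ 𝔪) (d : ℕ) :
    ExtVanishesBelow 𝔪 (QuotSMulTop x M) d ↔ ExtVanishesBelow 𝔪 M (d + 1) := by
  have hann : x ∈ Module.annihilator R (R ⧸ 𝔪) := by rwa [Ideal.annihilator_quotient]
  have hS := IsSMulRegular.smulShortComplex_shortExact (M := ModuleCat.of R M) hx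
  constructor
  · rintro h (_ | i) hi
    · have : Subsingleton ((R ⧸ 𝔪) →ₗ[R] M) :=
        IsSMulRegular.linearMap_subsingleton_of_mem_annihilator hx hann
      exact (Ext.addEquiv₀.trans ModuleCat.homAddEquiv).subsingleton
    · have hi' := h i (by omega)
      refine subsingleton_of_forall_eq 0 fun y => ?_
      have hy : y.comp (Ext.mk₀ ((ModuleCat.of R M).smulShortComplex x).f) (add_zero (i + 1))
          = 0 := by
        have := Ext.postcomp_smul_id_eq_zero_of_mem_annihilator (R := R)
          (M := ModuleCat.of R M) (N := ModuleCat.of R (R ⧸ 𝔪)) hann (i + 1)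
        exact congrArg (fun g => g.hom y) this
      obtain ⟨z, hz⟩ := Ext.covariant_sequence_exact₁ _ hS y hy rfl
      have hz0 : z = 0 := hi'.elim z 0
      rw [← hz, hz0, Ext.zero_comp]
      rfl
  · intro h i hi
    refine subsingleton_of_forall_eq 0 fun y => ?_
    obtain ⟨z, hz⟩ := Ext.covariant_sequence_exact₃ _ hS y rfl ((h (i + 1) (by omega)).elim _ _)
    have hz0 : z = 0 := (h i (by omega)).elim z 0
    rw [← hz, hz0, Ext.zero_comp]
    rfl

theorem not_one_quotient (h𝔪 : 𝔪 ≠ ⊤) : ¬ ExtVanishesBelow 𝔪 (R ⧸ 𝔪) 1 := by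
  intro h
  have h0 := h 0 one_pos
  have : Subsingleton ((R ⧸ 𝔪) →ₗ[R] (R ⧸ 𝔪)) :=
    ((Ext.addEquiv₀ (X := ModuleCat.of R (R ⧸ 𝔪)) (Y := ModuleCat.of R (R ⧸ 𝔪))).trans
      ModuleCat.homAddEquiv).symm.subsingleton
  have : Nontrivial (R ⧸ 𝔪) := Ideal.Quotient.nontrivial_iff.mpr h𝔪
  exact one_ne_zero (LinearMap.congr_fun
    (Subsingleton.elim (LinearMap.id : (R ⧸ 𝔪) →ₗ[R] (R ⧸ 𝔪)) 0) 1)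

/-- The Rees characterization of the lengths of regular sequences in `𝔪`. -/
theorem iff_exists_isRegular [IsNoetherianRing R] [Module.Finite R M]
    (h : 𝔪 • (⊤ : Submodule R M) < ⊤) (d : ℕ) :
    ExtVanishesBelow 𝔪 M d ↔ ∃ rs : List R, rs.length = d ∧ (∀ r ∈ rs, r ∈ 𝔪) ∧ IsRegular M rs := by
  have hsupp : Module.support R (R ⧸ 𝔪) = PrimeSpectrum.zeroLocus 𝔪 := by
    rw [Module.support_eq_zeroLocus, Ideal.annihilator_quotient]
  constructor
  · exact ModuleCat.exists_isRegular_of_exists_subsingleton_ext 𝔪 d (ModuleCat.of R M) h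
      (ModuleCat.of R (R ⧸ 𝔪)) hsupp
  · rintro ⟨rs, rfl, hrs, hreg⟩
    exact ModuleCat.subsingleton_ext_of_exists_isRegular 𝔪 (ModuleCat.of R (R ⧸ 𝔪)) hsupp.subset
      (ModuleCat.of R M) h rs hrs hreg

end ExtVanishesBelow

/-- A linear map whose range lies in the range of an injective linear map factors through it. -/
theorem LinearMap.exists_comp_eq_of_range_le {R A B C : Type*} [Ring R] [AddCommGroup A]
    [AddCommGroup B] [AddCommGroup C] [Module R A] [Module R B] [Module R C] (f : A →ₗ[R] C)
    (g : B →ₗ[R] C) (hg : Function.Injective g) (h : LinearMap.range f ≤ LinearMap.range g) :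
    ∃ k : A →ₗ[R] B, ∀ a, g (k a) = f a := by
  refine ⟨(LinearEquiv.ofInjective g hg).symm.toLinearMap ∘ₗ
    f.codRestrict (LinearMap.range g) fun a => h ⟨a, rfl⟩, fun a => ?_⟩
  have := LinearEquiv.apply_symm_apply (LinearEquiv.ofInjective g hg)
    (f.codRestrict (LinearMap.range g) (fun a => h ⟨a, rfl⟩) a)
  exact congrArg Subtype.val this

namespace QuotSMulTop

variable {R : Type*} [CommRing R] {M N : Type*} [AddCommGroup M] [Module R M] [AddCommGroup N]
  [Module R N]

/-- The class of an element in `M / xM`. -/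
abbrev mk (x : R) : M →ₗ[R] QuotSMulTop x M := Submodule.mkQ _

theorem mk_surjective (x : R) : Function.Surjective (mk (M := M) x) := Submodule.mkQ_surjective _

theorem mk_smul (x : R) (m : M) : mk x (x • m) = 0 :=
  (Submodule.Quotient.mk_eq_zero _).mpr (Submodule.smul_mem_pointwise_smul m x ⊤ trivial)

theorem exists_lift (x : R) (f : M →ₗ[R] N) (hf : ∀ m, f (x • m) = 0) :
    ∃ g : QuotSMulTop x M →ₗ[R] N, ∀ m, g (mk x m) = f m := by
  refine ⟨Submodule.liftQ _ f ?_, fun m => Submodule.liftQ_apply _ _ _⟩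
  intro m hm
  obtain ⟨m', -, rfl⟩ := (Submodule.mem_smul_pointwise_iff_exists _ _ _).mp hm
  exact hf m'

end QuotSMulTop

section Splitting

variable {R : Type} [CommRing R] {x : R} {I J : Ideal R}

open QuotSMulTop

/-- If `x` is regular modulo `J ≤ I` and `I ≤ J + (x)`, then `I / xI → J / xJ` retracts the map
induced by the inclusion and kills the elements of `I` divisible by `x`. -/
theorem exists_retraction_quotSMulTop (hJI : J ≤ I) (hJ : ∀ f, x * f ∈ J → f ∈ J)
    (hI : I ≤ J ⊔ Ideal.span {x}) :
    ∃ p : QuotSMulTop x I →ₗ[R] QuotSMulTop x J,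
      (∀ a : J, p (mk x (Submodule.inclusion hJI a)) = mk x a) ∧
      ∀ a : I, x ∣ (a : R) → p (mk x a) = 0 := by
  let π : R →ₗ[R] R ⧸ Ideal.span {x} := Submodule.mkQ _
  have hπ : ∀ a, π a = 0 ↔ x ∣ a := fun a =>
    (Submodule.Quotient.mk_eq_zero _).trans Ideal.mem_span_singleton
  obtain ⟨g, hg⟩ := exists_lift x (π ∘ₗ J.subtype) fun m =>
    (hπ _).mpr (by simp)
  have hinj : Function.Injective g := by
    rw [injective_iff_map_eq_zero]
    intro y hy
    obtain ⟨a, rfl⟩ := mk_surjective x y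
    rw [hg, LinearMap.comp_apply, hπ] at hy
    obtain ⟨f, hf⟩ := hy
    have hfa : a = x • (⟨f, hJ f (hf ▸ a.2)⟩ : J) := Subtype.ext hf
    rw [hfa, mk_smul]
  obtain ⟨k, hk⟩ := LinearMap.exists_comp_eq_of_range_le (π ∘ₗ I.subtype) g hinj (by
    rintro _ ⟨a, rfl⟩
    obtain ⟨b, hb, c, hc, hbc⟩ := Submodule.mem_sup.mp (hI a.2)
    refine ⟨mk x ⟨b, hb⟩, ?_⟩
    rw [hg]
    change π b = π a
    rw [← hbc, map_add, (hπ c).mpr (Ideal.mem_span_singleton.mp hc), add_zero])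
  have hk0 : ∀ a : I, x ∣ (a : R) → k a = 0 := fun a ha =>
    hinj (by rw [hk, map_zero]; exact (hπ _).mpr ha)
  obtain ⟨p, hp⟩ := exists_lift x k fun m => hk0 _ (by simp)
  refine ⟨p, fun a => hinj ?_, fun a ha => by rw [hp, hk0 a ha]⟩
  rw [hp, hk, hg]
  rfl

/-- If `I ≡ (u)` modulo `Q` and `u` is regular modulo `Q`, then division by `u` is a linear map
`I / xI → R / P` for every `P` containing `Q` and `x`. -/
theorem exists_division_quotSMulTop {P Q : Ideal R} (hQP : Q ≤ P) (hxP : x ∈ P) (u : R)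
    (hreg : ∀ f, u * f ∈ Q → f ∈ Q) (hI : I ≤ Q ⊔ Ideal.span {u}) :
    ∃ p : QuotSMulTop x I →ₗ[R] R ⧸ P,
      (∀ a : I, (a : R) = u → p (mk x a) = Submodule.Quotient.mk 1) ∧
      ∀ a : I, (a : R) ∈ Q → p (mk x a) = 0 := by
  let π : R →ₗ[R] R ⧸ Q := Submodule.mkQ _
  have hπ : ∀ a, π a = 0 ↔ a ∈ Q := fun a => Submodule.Quotient.mk_eq_zero _
  let g : (R ⧸ Q) →ₗ[R] R ⧸ Q := u • LinearMap.id
  have hg : ∀ a, g (π a) = π (u * a) := fun a => rfl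
  have hinj : Function.Injective g := by
    rw [injective_iff_map_eq_zero]
    intro y hy
    obtain ⟨a, rfl⟩ := Submodule.mkQ_surjective _ y
    change g (π a) = 0 at hy
    rw [hg, hπ] at hy
    exact (hπ a).mpr (hreg a hy)
  obtain ⟨k, hk⟩ := LinearMap.exists_comp_eq_of_range_le (π ∘ₗ I.subtype) g hinj (by
    rintro _ ⟨a, rfl⟩
    obtain ⟨b, hb, c, hc, hbc⟩ := Submodule.mem_sup.mp (hI a.2)
    obtain ⟨e, rfl⟩ := Ideal.mem_span_singleton.mp hc
    refine ⟨π e, ?_⟩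
    rw [hg]
    change π (u * e) = π a
    rw [← hbc, map_add, (hπ b).mpr hb, zero_add])
  let ρ : (R ⧸ Q) →ₗ[R] R ⧸ P := Submodule.mapQ Q P LinearMap.id hQP
  obtain ⟨p, hp⟩ := exists_lift x (ρ ∘ₗ k) (by
    intro m
    rw [map_smul]
    generalize (ρ ∘ₗ k) m = y
    obtain ⟨a, rfl⟩ := Submodule.mkQ_surjective _ y
    rw [← map_smul]
    exact (Submodule.Quotient.mk_eq_zero _).mpr (P.mul_mem_right a hxP))
  refine ⟨p, fun a ha => ?_, fun a ha => ?_⟩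
  · have : k a = π 1 := hinj (by
      rw [hk, hg, mul_one, ← ha]
      rfl)
    rw [hp, LinearMap.comp_apply, this]
    rfl
  · have : k a = 0 := hinj (by
      rw [hk, map_zero]
      exact (hπ _).mpr ha)
    rw [hp, LinearMap.comp_apply, this, map_zero]

/-- If `I / xI` splits as `J / xJ` plus the cyclic modules `R / P j` generated by the classes of
the `u j`, then the vanishing of `Ext` for `I` is controlled by these pieces. -/
theorem ExtVanishesBelow.succ_iff_of_splitting {𝔪 : Ideal R} {ι : Type} [Fintype ι]
    (hx : IsSMulRegular R x) (hx𝔪 : x ∈ 𝔪) (u : ι → R) (P Q : ι → Ideal R)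
    (hIeq : I = J ⊔ Ideal.span (Set.range u))
    (hJ : ∀ f, x * f ∈ J → f ∈ J) (hxu : ∀ j, x ∣ u j)
    (hQP : ∀ j, Q j ≤ P j) (hxP : ∀ j, x ∈ P j)
    (hPu : ∀ j, ∀ q ∈ P j, ∃ b ∈ I, q * u j = x * b)
    (hreg : ∀ j f, u j * f ∈ Q j → f ∈ Q j) (hJQ : ∀ j, J ≤ Q j)
    (huQ : ∀ i j, i ≠ j → u i ∈ Q j) (d : ℕ) :
    ExtVanishesBelow 𝔪 I (d + 1) ↔
      ExtVanishesBelow 𝔪 J (d + 1) ∧ ∀ j, ExtVanishesBelow 𝔪 (R ⧸ P j) d := by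
  classical
  have hJI : J ≤ I := hIeq ▸ le_sup_left
  have huI : ∀ j, u j ∈ I := fun j =>
    hIeq ▸ Ideal.mem_sup_right (Ideal.subset_span (Set.mem_range_self j))
  obtain ⟨p₀, hp₀, hp₀u⟩ := exists_retraction_quotSMulTop hJI hJ (by
    rw [hIeq, sup_le_iff, Ideal.span_le]
    refine ⟨le_sup_left, ?_⟩
    rintro _ ⟨j, rfl⟩
    exact Ideal.mem_sup_right (Ideal.mem_span_singleton.mpr (hxu j)))
  have hdiv := fun j => exists_division_quotSMulTop (I := I) (hQP j) (hxP j) (u j) (hreg j) (by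
    rw [hIeq, sup_le_iff, Ideal.span_le]
    refine ⟨(hJQ j).trans le_sup_left, ?_⟩
    rintro _ ⟨i, rfl⟩
    by_cases hij : i = j
    · subst hij
      exact Ideal.mem_sup_right (Ideal.mem_span_singleton_self _)
    · exact Ideal.mem_sup_left (huQ i j hij))
  choose p hpu hpQ using hdiv
  obtain ⟨s₀, hs₀⟩ := exists_lift x (mk x ∘ₗ Submodule.inclusion hJI) fun m => by
    rw [map_smul, LinearMap.comp_apply, ← map_smul, mk_smul]
  have hs : ∀ j, ∃ s : (R ⧸ P j) →ₗ[R] QuotSMulTop x I,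
      s (Submodule.Quotient.mk 1) = mk x ⟨u j, huI j⟩ := fun j => by
    refine ⟨Submodule.liftQ _ (LinearMap.toSpanSingleton R _ (mk x ⟨u j, huI j⟩)) ?_, ?_⟩
    · intro q hq
      obtain ⟨b, hb, hqb⟩ := hPu j q hq
      rw [LinearMap.mem_ker, LinearMap.toSpanSingleton_apply, ← map_smul]
      have : q • (⟨u j, huI j⟩ : I) = x • ⟨b, hb⟩ := Subtype.ext hqb
      rw [this, mk_smul]
    · exact (Submodule.liftQ_apply _ _ _).trans (one_smul _ _)
  choose s hs using hs
  rw [← quotSMulTop_iff (hx.submodule I x) hx𝔪, ← quotSMulTop_iff (hx.submodule J x) hx𝔪]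
  constructor
  · refine fun h => ⟨of_leftInverse s₀ p₀ ?_ h, fun j => of_leftInverse (s j) (p j) ?_ h⟩
    · refine Submodule.linearMap_qext _ (LinearMap.ext fun a => ?_)
      change p₀ (s₀ (mk x a)) = mk x a
      rw [hs₀, LinearMap.comp_apply, hp₀]
    · refine Submodule.linearMap_qext _ (LinearMap.ext_ring ?_)
      change p j (s j (Submodule.Quotient.mk 1)) = Submodule.Quotient.mk 1
      rw [hs, hpu _ _ rfl]
  · rintro ⟨h₀, h⟩
    refine of_sum_comp_eq_id (ι := Option ι)
      (N := fun o => o.elim (ModuleCat.of R (QuotSMulTop x J)) fun j => ModuleCat.of R (R ⧸ P j))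
      (fun o => match o with | none => p₀ | some j => p j)
      (fun o => match o with | none => s₀ | some j => s j) ?_
      (fun o => match o with | none => h₀ | some j => h j)
    rw [Fintype.sum_option]
    change s₀ ∘ₗ p₀ + ∑ j, s j ∘ₗ p j = LinearMap.id
    refine Submodule.linearMap_qext _ (LinearMap.ext ?_)
    have hgoal : ∀ a (ha : a ∈ I),
        (s₀ ∘ₗ p₀ + ∑ j, s j ∘ₗ p j) (mk x ⟨a, ha⟩) = mk x ⟨a, ha⟩ := by
      have hle : I ≤ (LinearMap.eqLocus ((s₀ ∘ₗ p₀ + ∑ j, s j ∘ₗ p j) ∘ₗ mk x) (mk x)).map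
          I.subtype := by
        conv_lhs => rw [hIeq]
        rw [sup_le_iff, Ideal.span_le]
        constructor
        · intro a ha
          refine ⟨⟨a, hJI ha⟩, ?_, rfl⟩
          have h1 := hp₀ ⟨a, ha⟩
          have h2 := hs₀ ⟨a, ha⟩
          have h3 : ∀ j, p j (mk x ⟨a, hJI ha⟩) = 0 := fun j => hpQ j _ (hJQ j ha)
          change p₀ (mk x ⟨a, hJI ha⟩) = _ at h1
          change (s₀ ∘ₗ p₀ + ∑ j, s j ∘ₗ p j) (mk x ⟨a, hJI ha⟩) = mk x ⟨a, hJI ha⟩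
          simp only [LinearMap.add_apply, LinearMap.sum_apply, LinearMap.comp_apply, h3, map_zero,
            Finset.sum_const_zero, add_zero, h1, h2]
          rfl
        · rintro _ ⟨i, rfl⟩
          refine ⟨⟨u i, huI i⟩, ?_, rfl⟩
          have h1 : p₀ (mk x ⟨u i, huI i⟩) = 0 := hp₀u _ (hxu i)
          change (s₀ ∘ₗ p₀ + ∑ j, s j ∘ₗ p j) (mk x ⟨u i, huI i⟩) = mk x ⟨u i, huI i⟩
          simp only [LinearMap.add_apply, LinearMap.sum_apply, LinearMap.comp_apply, h1, map_zero,
            zero_add]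
          rw [Finset.sum_eq_single i, hpu _ _ rfl, hs]
          · intro j _ hj
            rw [hpQ j _ (huQ i j hj.symm), map_zero]
          · simp
      intro a ha
      obtain ⟨b, hb, hba⟩ := hle ha
      obtain rfl : b = ⟨a, ha⟩ := Subtype.ext hba
      exact hb
    exact fun a => hgoal a a.2

end Splitting

namespace MvPolynomial

variable {R : Type*} [CommRing R] {σ : Type*}

theorem isPrime_span_X_image [IsDomain R] (A : Set σ) :
    (Ideal.span (X '' A) : Ideal (MvPolynomial σ R)).IsPrime := by
  classical
  let φ : MvPolynomial σ R →ₐ[R] MvPolynomial σ R := aeval fun i => if i ∈ A then 0 else X i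
  have hφ : ∀ f, f - φ f ∈ (Ideal.span (X '' A) : Ideal (MvPolynomial σ R)) := by
    intro f
    rw [← Ideal.Quotient.mk_eq_mk_iff_sub_mem]
    have : Ideal.Quotient.mkₐ R (Ideal.span (X '' A)) =
        (Ideal.Quotient.mkₐ R (Ideal.span (X '' A))).comp φ := by
      ext i
      by_cases hi : i ∈ A
      · have : (X i : MvPolynomial σ R) ∈ Ideal.span (X '' A) :=
          Ideal.subset_span (Set.mem_image_of_mem X hi)
        simpa [φ, hi] using Ideal.Quotient.eq_zero_iff_mem.mpr this
      · simp [φ, hi]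
    exact DFunLike.congr_fun this f
  have hker : (Ideal.span (X '' A) : Ideal (MvPolynomial σ R)) = RingHom.ker φ := by
    refine le_antisymm (Ideal.span_le.mpr ?_) fun f hf => ?_
    · rintro _ ⟨i, hi, rfl⟩
      simp [φ, RingHom.mem_ker, hi]
    · simpa [RingHom.mem_ker.mp hf] using hφ f
  rw [hker]
  exact RingHom.ker_isPrime φ

theorem monomial_mem_span_X_image [Nontrivial R] {A : Set σ} {a : σ →₀ ℕ} :
    monomial a (1 : R) ∈ Ideal.span (X '' A) ↔ ∃ i ∈ A, a i ≠ 0 := by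
  classical
  rw [mem_ideal_span_X_image, support_monomial, if_neg one_ne_zero]
  simp

theorem monomial_mem_span_monomial_image [Nontrivial R] {G : Set (σ →₀ ℕ)} {a : σ →₀ ℕ} :
    monomial a (1 : R) ∈ Ideal.span ((fun b => monomial b (1 : R)) '' G) ↔ ∃ g ∈ G, g ≤ a := by
  classical
  rw [mem_ideal_span_monomial_image, support_monomial, if_neg one_ne_zero]
  simp

/-- A variable not occurring in the generators of a monomial ideal is regular modulo the ideal. -/
theorem mem_span_monomial_image_of_X_mul_mem {G : Set (σ →₀ ℕ)} {k : σ} (hG : ∀ a ∈ G, a k = 0)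
    {f : MvPolynomial σ R} (h : X k * f ∈ Ideal.span ((fun b => monomial b (1 : R)) '' G)) :
    f ∈ Ideal.span ((fun b => monomial b (1 : R)) '' G) := by
  classical
  rw [mem_ideal_span_monomial_image] at h ⊢
  intro m hm
  obtain ⟨g, hg, hgm⟩ := h (Finsupp.single k 1 + m) (by
    rw [support_X_mul]
    exact Finset.mem_map_of_mem _ hm)
  refine ⟨g, hg, fun i => ?_⟩
  by_cases hik : i = k
  · rw [hik, hG g hg]
    exact Nat.zero_le _
  · simpa [Finsupp.single_apply, Ne.symm hik] using hgm i

theorem X_mul_monomial_eq {a : σ →₀ ℕ} {i k : σ} (hk : a k ≠ 0) :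
    X i * monomial a (1 : R) =
      X k * monomial (a + Finsupp.single i 1 - Finsupp.single k 1) (1 : R) := by
  have hle : Finsupp.single k 1 ≤ a + Finsupp.single i 1 := by
    rw [Finsupp.single_le_iff, Finsupp.add_apply]
    omega
  simp only [X, monomial_mul, one_mul]
  rw [add_tsub_cancel_of_le hle, add_comm]

end MvPolynomial

section MonomialIdeals

variable {K : Type} [Field K] {n : ℕ} {I : Ideal (MvPolynomial (Fin n) K)}

theorem maxIdeal_ne_top : maxIdeal K n ≠ ⊤ := by
  have := (isPrime_span_X_image (R := K) (Set.univ : Set (Fin n))).ne_top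
  rwa [Set.image_univ] at this

theorem X_mem_maxIdeal (i : Fin n) : (X i : MvPolynomial (Fin n) K) ∈ maxIdeal K n :=
  Ideal.subset_span (Set.mem_range_self i)

open scoped Pointwise in
/-- The quotient by the variables in `A` has depth `n - |A|`. -/
theorem extVanishesBelow_quotient_span_X_image (A : Finset (Fin n)) (d : ℕ) :
    ExtVanishesBelow (maxIdeal K n)
      (MvPolynomial (Fin n) K ⧸
        (Ideal.span (X '' (A : Set (Fin n))) : Ideal (MvPolynomial (Fin n) K))) d ↔
        d + A.card ≤ n := by
  classical
  induction d generalizing A with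
  | zero => simpa [ExtVanishesBelow.zero] using A.card_le_univ
  | succ d ih =>
    by_cases hA : A = Finset.univ
    · subst hA
      have hspan : (Ideal.span (X '' ((Finset.univ : Finset (Fin n)) : Set (Fin n))) :
          Ideal (MvPolynomial (Fin n) K)) = maxIdeal K n := by
        rw [Finset.coe_univ, Set.image_univ, maxIdeal]
      rw [hspan]
      refine iff_of_false (fun h => ?_) (by simp)
      exact ExtVanishesBelow.not_one_quotient maxIdeal_ne_top fun i hi => h i (by omega)
    · obtain ⟨j, hj⟩ : ∃ j, j ∉ A := by
        by_contra! h
        exact hA (Finset.eq_univ_iff_forall.mpr h)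
      have hprime := isPrime_span_X_image (R := K) (A : Set (Fin n))
      have hjP : (X j : MvPolynomial (Fin n) K) ∉ Ideal.span (X '' (A : Set (Fin n))) := by
        rw [X, monomial_mem_span_X_image]
        rintro ⟨i, hi, hij⟩
        refine hj ?_
        rw [Finsupp.single_apply_ne_zero] at hij
        exact hij.1 ▸ hi
      have hreg : IsSMulRegular
          (MvPolynomial (Fin n) K ⧸ (Ideal.span (X '' (A : Set (Fin n))) :
            Ideal (MvPolynomial (Fin n) K)))
          (X j : MvPolynomial (Fin n) K) := by
        rw [isSMulRegular_quotient_iff_mem_of_smul_mem]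
        exact fun f hf => (hprime.mem_or_mem hf).resolve_left hjP
      rw [← ExtVanishesBelow.quotSMulTop_iff hreg (X_mem_maxIdeal j)]
      have hins : (Ideal.span (X '' (A : Set (Fin n))) ⊔ Ideal.span {X j} :
          Ideal (MvPolynomial (Fin n) K)) = Ideal.span (X '' ((insert j A : Finset _) : Set _)) := by
        rw [← Ideal.span_union, Finset.coe_insert, Set.image_insert_eq, Set.union_singleton]
      have hmap : (X j : MvPolynomial (Fin n) K) • (⊤ : Submodule (MvPolynomial (Fin n) K)
          (MvPolynomial (Fin n) K ⧸ (Ideal.span (X '' (A : Set (Fin n))) :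
            Ideal (MvPolynomial (Fin n) K)))) =
          Submodule.map (Submodule.mkQ (Ideal.span (X '' (A : Set (Fin n)))))
            (Ideal.span {(X j : MvPolynomial (Fin n) K)}) := by
        rw [← Submodule.ideal_span_singleton_smul, ← Submodule.range_mkQ, ← Submodule.map_top,
          ← Submodule.map_smul'', smul_eq_mul, Ideal.mul_top]
      rw [ExtVanishesBelow.congr ((Submodule.quotEquivOfEq _ _ hmap).trans
        ((Submodule.quotientQuotientEquivQuotientSup _ _).trans
          (Submodule.quotEquivOfEq _ _ hins))), ih, Finset.card_insert_of_notMem hj]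
      omega

theorem mvar_le_iff {a : Fin n →₀ ℕ} {k : ℕ} : mvar a ≤ k ↔ ∀ i, a i ≠ 0 → (i : ℕ) < k := by
  simp [mvar, Finset.sup_le_iff]

theorem mvar_le (a : Fin n →₀ ℕ) : mvar a ≤ n := mvar_le_iff.mpr fun i _ => i.2

theorem exists_mem_minGens_le {a : Fin n →₀ ℕ} (ha : a ∈ expSet I) : ∃ b ∈ minGens I, b ≤ a := by
  obtain ⟨b, hba, hb⟩ := exists_minimal_le_of_wellFoundedLT (· ∈ expSet I) a ha
  exact ⟨b, ⟨hb.prop, fun c hc hcb => hb.eq_of_le hc hcb⟩, hba⟩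

theorem IsSqfreeMonomialIdeal.isSqfree_of_mem_minGens (h : IsSqfreeMonomialIdeal I)
    {a : Fin n →₀ ℕ} (ha : a ∈ minGens I) : IsSqfree a := by
  obtain ⟨G, hG, rfl⟩ := h
  obtain ⟨g, hg, hga⟩ := monomial_mem_span_monomial_image.mp ha.1
  rw [← ha.2 g (Ideal.subset_span (Set.mem_image_of_mem _ hg)) hga]
  exact hG g hg

theorem IsSqfree.edeg_eq_card_support {a : Fin n →₀ ℕ} (ha : IsSqfree a) :
    edeg a = a.support.card := by
  rw [edeg, Finset.card_eq_sum_ones, ← Finset.sum_subset a.support.subset_univ]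
  · refine Finset.sum_congr rfl fun i hi => ?_
    have := Finsupp.mem_support_iff.mp hi
    have := ha i
    omega
  · simp

theorem IsSqfreeMonomialIdeal.finite_minGens (h : IsSqfreeMonomialIdeal I) :
    (minGens I).Finite := by
  refine (Set.finite_Iic (Finsupp.equivFunOnFinite.symm fun _ : Fin n => 1)).subset fun a ha i => ?_
  exact h.isSqfree_of_mem_minGens ha i

/-- The ideal generated by the minimal generators of `I` in the first `k` variables. -/
def truncIdeal (I : Ideal (MvPolynomial (Fin n) K)) (k : ℕ) : Ideal (MvPolynomial (Fin n) K) :=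
  Ideal.span ((fun a => monomial a (1 : K)) '' {a | a ∈ minGens I ∧ mvar a ≤ k})

theorem IsSqfreeMonomialIdeal.truncIdeal_self (h : IsSqfreeMonomialIdeal I) :
    truncIdeal I n = I := by
  refine le_antisymm (Ideal.span_le.mpr ?_) ?_
  · rintro _ ⟨a, ha, rfl⟩
    exact ha.1.1
  · obtain ⟨G, -, hG⟩ := h
    conv_lhs => rw [hG]
    refine Ideal.span_le.mpr ?_
    rintro _ ⟨g, hg, rfl⟩
    have hgI : g ∈ expSet I := by
      rw [hG]
      exact Ideal.subset_span (Set.mem_image_of_mem _ hg)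
    obtain ⟨b, hb, hbg⟩ := exists_mem_minGens_le hgI
    exact monomial_mem_span_monomial_image.mpr ⟨b, ⟨hb, mvar_le b⟩, hbg⟩

theorem IsSqfreeStable.extVanishesBelow_truncIdeal_succ (hst : IsSqfreeStable I) (k : Fin n)
    (d : ℕ) :
    ExtVanishesBelow (maxIdeal K n) (truncIdeal I (k + 1)) (d + 1) ↔
      ExtVanishesBelow (maxIdeal K n) (truncIdeal I k) (d + 1) ∧
        ∀ a ∈ minGens I, mvar a = k + 1 → d + 1 ≤ n - mvar a + edeg a := by
  classical
  have hsq : ∀ a ∈ minGens I, IsSqfree a := fun a ha => hst.1.isSqfree_of_mem_minGens ha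
  let ι := {a // a ∈ minGens I ∧ mvar a = (k : ℕ) + 1}
  have : Finite ι := (hst.1.finite_minGens.subset fun a ha => ha.1 :
    {a | a ∈ minGens I ∧ mvar a = (k : ℕ) + 1}.Finite)
  have : Fintype ι := Fintype.ofFinite ι
  let B : ι → Finset (Fin n) := fun a => Finset.Iic k \ a.1.support
  have hk : ∀ a : ι, a.1 k ≠ 0 := by
    intro a h0
    have h1 := a.2.2
    have h2 : mvar a.1 ≤ k := mvar_le_iff.mpr fun i hi => by
      have h3 := mvar_le_iff.mp h1.le i hi
      have h4 : i ≠ k := fun h => hi (h ▸ h0)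
      have h5 := Fin.val_ne_of_ne h4
      omega
    omega
  have hkB : ∀ a : ι, k ∉ B a := fun a h =>
    (Finset.mem_sdiff.mp h).2 (Finsupp.mem_support_iff.mpr (hk a))
  have htop : ∀ (a : ι) (l : Fin n), k < l → a.1 l = 0 := by
    intro a l hl
    by_contra h
    have h1 := mvar_le_iff.mp a.2.2.le l h
    have h2 := Fin.lt_def.mp hl
    omega
  have hdeg : ∀ a : ι, (insert k (B a)).card + edeg a.1 = k + 2 := by
    intro a
    have hsub : a.1.support ⊆ Finset.Iic k := fun l hl => by
      rw [Finset.mem_Iic]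
      exact not_lt.mp fun h => Finsupp.mem_support_iff.mp hl (htop a l h)
    have h1 := Finset.card_sdiff_add_card_eq_card hsub
    rw [Fin.card_Iic] at h1
    change (B a).card + _ = _ at h1
    rw [Finset.card_insert_of_notMem (hkB a), (hsq _ a.2.1).edeg_eq_card_support]
    omega
  have hB : ∀ (a : ι) (b : Fin n →₀ ℕ), b ∈ minGens I → mvar b ≤ (k : ℕ) + 1 → b ≠ a.1 →
      monomial b (1 : K) ∈ (Ideal.span (X '' (B a : Set (Fin n))) : Ideal _) := by
    intro a b hb hbk hba
    rw [monomial_mem_span_X_image]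
    by_contra! h
    refine hba (a.2.1.2 b hb.1 fun i => ?_)
    by_cases hbi : b i = 0
    · omega
    · have h1 : i ∈ Finset.Iic k := by
        rw [Finset.mem_Iic, Fin.le_def]
        exact Nat.lt_succ_iff.mp (mvar_le_iff.mp hbk i hbi)
      have h2 : a.1 i ≠ 0 := fun h0 => hbi (h i (by simpa [B, h0] using h1))
      have := hsq b hb i
      omega
  have huP : ∀ (a : ι), ∀ q ∈ (Ideal.span (X '' (((insert k (B a) : Finset _)) : Set (Fin n))) :
      Ideal (MvPolynomial (Fin n) K)),
      ∃ b ∈ truncIdeal I (k + 1), q * monomial a.1 (1 : K) = X k * b := by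
    intro a q hq
    refine Submodule.span_induction ?_ ⟨0, zero_mem _, by simp⟩ ?_ ?_ hq
    · rintro _ ⟨i, hi, rfl⟩
      rcases Finset.mem_insert.mp hi with rfl | hi
      · exact ⟨_, Ideal.subset_span (Set.mem_image_of_mem _ ⟨a.2.1, a.2.2.le⟩), rfl⟩
      · refine ⟨_, ?_, X_mul_monomial_eq (hk a)⟩
        have hiB := Finset.mem_sdiff.mp hi
        have hai : a.1 i = 0 := by simpa using hiB.2
        have hik : i < k := lt_of_le_of_ne (Finset.mem_Iic.mp hiB.1) fun h => hk a (h ▸ hai)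
        obtain ⟨g, hg, hga⟩ := exists_mem_minGens_le
          (hst.2 a.1 (hsq _ a.2.1) a.2.1.1 k (hk a) (htop a) i hik hai)
        refine monomial_mem_span_monomial_image.mpr ⟨g, ⟨hg, mvar_le_iff.mpr fun l hl => ?_⟩, hga⟩
        by_contra hkl
        have h1 : k < l := Fin.lt_def.mpr (by omega)
        have h2 := hga l
        rw [Finsupp.tsub_apply, Finsupp.add_apply, htop a l h1,
          Finsupp.single_eq_of_ne (hik.trans h1).ne'] at h2
        omega
    · rintro p q - - ⟨b, hb, hpb⟩ ⟨c, hc, hqc⟩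
      exact ⟨b + c, add_mem hb hc, by rw [add_mul, hpb, hqc, mul_add]⟩
    · rintro r p - ⟨b, hb, hpb⟩
      exact ⟨r * b, Ideal.mul_mem_left _ r hb, by rw [smul_eq_mul, mul_assoc, hpb]; ring⟩
  have hQ : ∀ (a : ι) (f : MvPolynomial (Fin n) K),
      monomial a.1 (1 : K) * f ∈ (Ideal.span (X '' (B a : Set (Fin n))) : Ideal _) →
        f ∈ (Ideal.span (X '' (B a : Set (Fin n))) : Ideal _) := by
    intro a f hf
    refine ((isPrime_span_X_image _).mem_or_mem hf).resolve_left fun h => ?_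
    obtain ⟨i, hi, hai⟩ := monomial_mem_span_X_image.mp h
    exact (Finset.mem_sdiff.mp hi).2 (Finsupp.mem_support_iff.mpr hai)
  rw [ExtVanishesBelow.succ_iff_of_splitting (x := (X k : MvPolynomial (Fin n) K))
    (I := truncIdeal I (k + 1)) (J := truncIdeal I k) (𝔪 := maxIdeal K n)
    (fun _ _ h => mul_left_cancel₀ (X_ne_zero k) h) (X_mem_maxIdeal k)
    (fun a : ι => monomial a.1 (1 : K))
    (fun a => Ideal.span (X '' (((insert k (B a) : Finset _)) : Set (Fin n))))
    (fun a => Ideal.span (X '' (B a : Set (Fin n)))) ?_ ?_ ?_ ?_ ?_ huP hQ ?_ ?_ d]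
  · refine and_congr_right fun _ => ?_
    simp only [extVanishesBelow_quotient_span_X_image]
    refine ⟨fun h a ha hak => ?_, fun h a => ?_⟩
    · have h1 := h ⟨a, ha, hak⟩
      have h2 := hdeg ⟨a, ha, hak⟩
      have h3 := k.2
      dsimp only at h1 h2
      omega
    · have h1 := h a.1 a.2.1 a.2.2
      have h2 := hdeg a
      have h3 := k.2
      have h4 := a.2.2
      omega
  · rw [truncIdeal, truncIdeal, ← Ideal.span_union]
    congr 1
    ext f
    constructor
    · rintro ⟨a, ⟨ha, hak⟩, rfl⟩
      rcases Nat.le_succ_iff.mp hak with h | h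
      · exact Or.inl ⟨a, ⟨ha, h⟩, rfl⟩
      · exact Or.inr ⟨⟨a, ha, h⟩, rfl⟩
    · rintro (⟨a, ⟨ha, hak⟩, rfl⟩ | ⟨a, rfl⟩)
      · exact ⟨a, ⟨ha, Nat.le_succ_of_le hak⟩, rfl⟩
      · exact ⟨a.1, ⟨a.2.1, a.2.2.le⟩, rfl⟩
  · intro f hf
    refine mem_span_monomial_image_of_X_mul_mem (fun a ha => ?_) hf
    by_contra h
    exact (mvar_le_iff.mp ha.2 k h).false
  · intro a
    exact X_dvd_monomial.mpr (Or.inr (hk a))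
  · intro a
    exact Ideal.span_mono (Set.image_mono (by simp))
  · intro a
    exact Ideal.subset_span (Set.mem_image_of_mem _ (by simp))
  · intro a
    refine Ideal.span_le.mpr ?_
    rintro _ ⟨b, ⟨hb, hbk⟩, rfl⟩
    refine hB a b hb (Nat.le_succ_of_le hbk) ?_
    rintro rfl
    have := a.2.2
    omega
  · intro a b hab
    exact hB b a.1 a.2.1 a.2.2.le fun h => hab (Subtype.ext h)

theorem IsSqfreeStable.extVanishesBelow_truncIdeal (hst : IsSqfreeStable I) {k : ℕ} (hk : k ≤ n)
    (d : ℕ) :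
    ExtVanishesBelow (maxIdeal K n) (truncIdeal I k) d ↔
      ∀ a ∈ minGens I, mvar a ≤ k → d ≤ n - mvar a + edeg a := by
  rcases d with _ | d
  · simp [ExtVanishesBelow.zero]
  induction k with
  | zero =>
    have hzero : ∀ a : Fin n →₀ ℕ, mvar a ≤ 0 ↔ a = 0 := fun a => by
      rw [mvar_le_iff]
      exact ⟨fun h => Finsupp.ext fun i => by_contra fun hi => absurd (h i hi) (Nat.not_lt_zero _),
        by rintro rfl; simp⟩
    simp only [hzero]
    by_cases h0 : (0 : Fin n →₀ ℕ) ∈ minGens I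
    · have htop : truncIdeal I 0 = ⊤ := (Ideal.eq_top_iff_one _).mpr
        (Ideal.subset_span ⟨0, ⟨h0, (hzero 0).mpr rfl⟩, rfl⟩)
      have hbot : (Ideal.span (X '' ((∅ : Finset (Fin n)) : Set (Fin n))) :
          Ideal (MvPolynomial (Fin n) K)) = ⊥ := by simp
      rw [htop, ExtVanishesBelow.congr (Submodule.topEquiv.trans
        (Submodule.quotEquivOfEqBot _ hbot).symm), extVanishesBelow_quotient_span_X_image]
      have hm : mvar (0 : Fin n →₀ ℕ) = 0 := Nat.le_zero.mp ((hzero 0).mpr rfl)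
      constructor
      · rintro h a - rfl
        simp only [Finset.card_empty] at h
        rw [hm]
        omega
      · intro h
        simpa [hm, edeg] using h 0 h0 rfl
    · have hbot : truncIdeal I 0 = ⊥ := by
        rw [truncIdeal, Ideal.span_eq_bot]
        rintro _ ⟨a, ⟨ha, ha0⟩, rfl⟩
        exact absurd ((hzero a).mp ha0 ▸ ha) h0
      rw [hbot]
      refine iff_of_true (ExtVanishesBelow.of_subsingleton _) ?_
      rintro a ha rfl
      exact absurd ha h0
  | succ k ih =>
    rw [hst.extVanishesBelow_truncIdeal_succ ⟨k, hk⟩ d, ih (by omega)]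
    constructor
    · rintro ⟨h1, h2⟩ a ha hak
      rcases Nat.le_succ_iff.mp hak with h | h
      exacts [h1 a ha h, h2 a ha h]
    · exact fun h => ⟨fun a ha hak => h a ha (Nat.le_succ_of_le hak), fun a ha hak => h a ha hak.le⟩

theorem maxIdeal_smul_top_lt (hI : I ≠ ⊥) :
    maxIdeal K n • (⊤ : Submodule (MvPolynomial (Fin n) K) I) < ⊤ := by
  refine lt_top_iff_ne_top.mpr fun h => ?_
  obtain ⟨r, hr, hr0⟩ := Submodule.exists_sub_one_mem_and_smul_eq_zero_of_fg_of_le_smul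
    (maxIdeal K n) (⊤ : Submodule (MvPolynomial (Fin n) K) I) (Module.Finite.fg_top) h.ge
  obtain ⟨f, hf, hf0⟩ := Submodule.exists_mem_ne_zero_of_ne_bot hI
  have h1 : r * f = 0 := congrArg Subtype.val (hr0 ⟨f, hf⟩ trivial)
  rw [(mul_eq_zero.mp h1).resolve_right hf0, zero_sub, neg_mem_iff] at hr
  exact maxIdeal_ne_top ((Ideal.eq_top_iff_one _).mpr hr)

end MonomialIdeals

/-- Lemma `depth1`(b). Let `I ⊂ S = K[x_1,…,x_n]` be a nonzero
squarefree stable monomial ideal. Then `depth(I) = min{n − m(u) + deg(u) : u ∈ G(I)}`. -/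
theorem depth_sqfreeStable_eq {K : Type} [Field K] {n : ℕ}
    (I : Ideal (MvPolynomial (Fin n) K)) (hst : IsSqfreeStable I) (hI : I ≠ ⊥) :
    mdepth K n ↥I = ((sInf {m | ∃ a ∈ minGens I, m = n - mvar a + edeg a} : ℕ) : ℕ∞) := by
  have hne : {m | ∃ a ∈ minGens I, m = n - mvar a + edeg a}.Nonempty := by
    obtain ⟨G, hG⟩ := hst.1
    obtain ⟨g, hg⟩ : G.Nonempty := by
      rw [Set.nonempty_iff_ne_empty]
      rintro rfl
      exact hI (by simpa using hG.2)
    have hgI : g ∈ expSet I := by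
      rw [hG.2]
      exact Ideal.subset_span (Set.mem_image_of_mem _ hg)
    obtain ⟨b, hb, -⟩ := exists_mem_minGens_le hgI
    exact ⟨_, b, hb, rfl⟩
  have hiff : ∀ d, (∃ rs : List (MvPolynomial (Fin n) K), rs.length = d ∧
      (∀ r ∈ rs, r ∈ maxIdeal K n) ∧ RingTheory.Sequence.IsRegular I rs) ↔
      d ≤ sInf {m | ∃ a ∈ minGens I, m = n - mvar a + edeg a} := by
    intro d
    rw [← ExtVanishesBelow.iff_exists_isRegular (maxIdeal_smul_top_lt hI)]
    have h := hst.extVanishesBelow_truncIdeal le_rfl d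
    rw [hst.1.truncIdeal_self] at h
    rw [h, le_csInf_iff'' hne]
    exact ⟨fun h m ⟨a, ha, hm⟩ => hm ▸ h a ha (mvar_le a), fun h a ha _ => h _ ⟨a, ha, rfl⟩⟩
  refine le_antisymm (sSup_le ?_) (le_sSup ?_)
  · rintro _ ⟨rs, hrs, hreg, rfl⟩
    exact Nat.cast_le.mpr ((hiff _).mp ⟨rs, rfl, hrs, hreg⟩)
  · obtain ⟨rs, hlen, hrs, hreg⟩ := (hiff _).mpr le_rfl
    exact ⟨rs, hrs, hreg, by rw [hlen]⟩
end
end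

section
/- Suppose I and I' are lexsegment ideals of S = K[x_1,…,x_n], generated by monomials of degree d and d' respectively, with μ(I) = μ(I') and d' ≥ d. Then hdepth_1(I) = hdepth_1(I'), hdepth_n(I) = hdepth_n(I'), sdepth_1(I) = sdepth_1(I'), and sdepth_n(I) = sdepth_n(I'). -/
noncomputable section

open MvPolynomial

open MvPolynomial

section LexSets

variable {n : ℕ}

lemma edeg_eq_degree (a : Fin n →₀ ℕ) : edeg a = a.degree := by
  rw [edeg, Finsupp.degree_eq_sum]

lemma edeg_add (a b : Fin n →₀ ℕ) : edeg (a + b) = edeg a + edeg b := by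
  simp [edeg_eq_degree]

lemma edeg_single (i : Fin n) (c : ℕ) : edeg (Finsupp.single i c) = c := by
  simp [edeg_eq_degree]

lemma edeg_mono {a b : Fin n →₀ ℕ} (h : a ≤ b) : edeg a ≤ edeg b :=
  Finset.sum_le_sum fun i _ => h i

lemma eq_of_le_of_edeg_le {a b : Fin n →₀ ℕ} (h : a ≤ b) (hd : edeg b ≤ edeg a) : a = b := by
  obtain ⟨e, rfl⟩ := exists_add_of_le h
  rw [edeg_add] at hd
  have he : e.degree = 0 := by rw [← edeg_eq_degree]; omega
  rw [Finsupp.degree_eq_zero_iff] at he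
  simp [he]

lemma finite_edeg_eq (n d : ℕ) : {a : Fin n →₀ ℕ | edeg a = d}.Finite := by
  refine Set.Finite.of_finite_image (f := fun a : Fin n →₀ ℕ => (a : Fin n → ℕ)) ?_
    DFunLike.coe_injective.injOn
  refine (Set.Finite.pi' (t := fun _ : Fin n => Set.Iic d) fun _ => Set.finite_Iic d).subset ?_
  rintro _ ⟨a, rfl, rfl⟩ i
  exact Finset.single_le_sum (f := fun i => a i) (fun _ _ => Nat.zero_le _) (Finset.mem_univ i)

lemma lexGT_or_lexGT_of_ne {a b : Fin n →₀ ℕ} (h : a ≠ b) : lexGT a b ∨ lexGT b a := by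
  obtain ⟨i, hi, hmin⟩ := WellFounded.has_min (wellFounded_lt (α := Fin n)) {i | a i ≠ b i}
    (by by_contra hne; exact h (Finsupp.ext fun i => by_contra fun hi => hne ⟨i, hi⟩))
  have heq : ∀ j < i, a j = b j := fun j hj => by_contra fun hne => hmin j hne hj
  rcases lt_or_gt_of_ne hi with hlt | hlt
  · exact Or.inr ⟨i, fun j hj => (heq j hj).symm, hlt⟩
  · exact Or.inl ⟨i, heq, hlt⟩

lemma IsLexSet.finite {d : ℕ} {L : Set (Fin n →₀ ℕ)} (hL : IsLexSet d L) : L.Finite :=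
  (finite_edeg_eq n d).subset hL.1

lemma IsLexSet.subset_or_subset {d : ℕ} {L L' : Set (Fin n →₀ ℕ)} (hL : IsLexSet d L)
    (hL' : IsLexSet d L') : L ⊆ L' ∨ L' ⊆ L := by
  by_contra! h
  obtain ⟨⟨a, ha, ha'⟩, b, hb', hb⟩ := Set.not_subset.1 h.1, Set.not_subset.1 h.2
  rcases lexGT_or_lexGT_of_ne (a := a) (b := b) (by rintro rfl; exact hb ha) with hab | hab
  · exact ha' (hL'.2 b hb' a (hL.1 a ha) hab)
  · exact hb (hL.2 a ha b (hL'.1 b hb') hab)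

lemma IsLexSet.eq_of_ncard_eq {d : ℕ} {L L' : Set (Fin n →₀ ℕ)} (hL : IsLexSet d L)
    (hL' : IsLexSet d L') (h : L.ncard = L'.ncard) : L = L' := by
  rcases hL.subset_or_subset hL' with hs | hs
  · exact Set.eq_of_subset_of_ncard_le hs h.ge hL'.finite
  · exact (Set.eq_of_subset_of_ncard_le hs h.le hL.finite).symm

/-- Multiplication by a power of the largest variable preserves lexsegment sets. -/
lemma IsLexSet.image_add_single_zero {d : ℕ} {L : Set (Fin (n + 1) →₀ ℕ)} (hL : IsLexSet d L)
    (c : ℕ) : IsLexSet (d + c) ((· + Finsupp.single 0 c) '' L) := by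
  refine ⟨?_, ?_⟩
  · rintro _ ⟨a, ha, rfl⟩
    simp [edeg_add, edeg_single, hL.1 a ha]
  · rintro _ ⟨a, ha, rfl⟩ b hb ⟨i, hlt, hi⟩
    have hc : Finsupp.single 0 c ≤ b := by
      rw [Finsupp.single_le_iff]
      rcases Fin.eq_zero_or_eq_succ i with rfl | ⟨k, rfl⟩
      · simp at hi; omega
      · have := hlt 0 (Fin.succ_pos k)
        simp at this; omega
    obtain ⟨b, rfl⟩ := exists_add_of_le hc
    rw [add_comm (Finsupp.single 0 c) b] at hb hlt hi ⊢
    refine ⟨b, hL.2 a ha b ?_ ⟨i, fun j hj => ?_, ?_⟩, rfl⟩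
    · rw [edeg_add, edeg_single] at hb; omega
    · simpa using hlt j hj
    · simpa using hi

/-- Lexsegment sets of the same cardinality in different degrees differ by multiplication
with a monomial. -/
lemma IsLexSet.exists_eq_image_add {d d' : ℕ} {L L' : Set (Fin n →₀ ℕ)} (hL : IsLexSet d L)
    (hL' : IsLexSet d' L') (hd : d ≤ d') (h : L.ncard = L'.ncard) :
    ∃ s : Fin n →₀ ℕ, L' = (· + s) '' L := by
  rcases n with _ | n
  · refine ⟨0, ?_⟩
    rcases L.eq_empty_or_nonempty with rfl | hne
    · rw [Set.ncard_empty] at h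
      simpa using (Set.ncard_eq_zero hL'.finite).1 h.symm
    · have hne' : L'.Nonempty := by
        rw [← Set.ncard_pos hL'.finite, ← h, Set.ncard_pos hL.finite]; exact hne
      simp [Subsingleton.eq_univ_of_nonempty hne, Subsingleton.eq_univ_of_nonempty hne']
  · refine ⟨Finsupp.single 0 (d' - d), hL'.eq_of_ncard_eq ?_ ?_⟩
    · simpa [Nat.add_sub_cancel' hd] using hL.image_add_single_zero (d' - d)
    · rw [Set.ncard_image_of_injective _ (add_left_injective _), h]

end LexSets

section Generators

variable {K : Type} [Field K] {n : ℕ}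

lemma coeff_eq_zero_of_mem_span_monomial {d : ℕ} {G : Set (Fin n →₀ ℕ)}
    (hG : ∀ a ∈ G, edeg a = d) {p : MvPolynomial (Fin n) K}
    (hp : p ∈ Ideal.span ((fun a => monomial a (1 : K)) '' G)) {b : Fin n →₀ ℕ}
    (hb : edeg b < d) : coeff b p = 0 := by
  by_contra hne
  obtain ⟨a, ha, hab⟩ := mem_ideal_span_monomial_image.1 hp b (mem_support_iff.2 hne)
  have := edeg_mono hab
  rw [hG a ha] at this
  omega

lemma coeff_mul_of_forall_coeff_eq_zero {d : ℕ} {p : MvPolynomial (Fin n) K}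
    (hp : ∀ b, edeg b < d → coeff b p = 0) (q : MvPolynomial (Fin n) K) {b : Fin n →₀ ℕ}
    (hb : edeg b = d) : coeff b (q * p) = coeff 0 q * coeff b p := by
  classical
  rw [coeff_mul]
  refine Finset.sum_eq_single (0, b) ?_ (by simp)
  rintro ⟨e, f⟩ hef hne
  replace hef : e + f = b := Finset.HasAntidiagonal.mem_antidiagonal.1 hef
  dsimp only
  subst hef
  by_cases hf : edeg f < d
  · rw [hp f hf, mul_zero]
  · have : f = e + f := eq_of_le_of_edeg_le le_add_self (by omega)
    have he : e = 0 := by simpa using this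
    simp [he] at hne

/-- The minimal number of generators of an ideal generated by monomials of degree `d`. -/
lemma mu_span_monomial {d : ℕ} {G : Set (Fin n →₀ ℕ)} (hG : ∀ a ∈ G, edeg a = d) :
    mu (Ideal.span ((fun a => monomial a (1 : K)) '' G)) = G.ncard := by
  classical
  have hfin : G.Finite := (finite_edeg_eq n d).subset hG
  have hinj : Function.Injective fun a : Fin n →₀ ℕ => monomial a (1 : K) :=
    monomial_left_injective one_ne_zero
  refine IsLeast.csInf_eq ⟨⟨(hfin.image fun a => monomial a (1 : K)).toFinset, ?_, by simp⟩, ?_⟩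
  · rw [← Set.ncard_eq_toFinset_card _ (hfin.image _), Set.ncard_image_of_injective _ hinj]
  · rintro _ ⟨F, rfl, hF⟩
    have : Fintype G := hfin.fintype
    let ψ : MvPolynomial (Fin n) K →ₗ[K] (G → K) := LinearMap.pi fun b => lcoeff K (b : Fin n →₀ ℕ)
    have hψ (p) (b : G) : ψ p b = coeff (b : Fin n →₀ ℕ) p := rfl
    have hmem : ∀ p ∈ Ideal.span (F : Set (MvPolynomial (Fin n) K)),
        ψ p ∈ Submodule.span K (F.image ψ : Set (G → K)) := by
      intro p hp
      induction hp using Submodule.span_induction with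
      | mem x hx => exact Submodule.subset_span (by simpa using ⟨x, hx, rfl⟩)
      | zero => simp
      | add x y _ _ hx hy => rw [map_add]; exact add_mem hx hy
      | smul a x hx ih =>
        have hax : ψ (a • x) = coeff 0 a • ψ x := by
          ext b
          rw [smul_eq_mul, hψ, coeff_mul_of_forall_coeff_eq_zero
            (fun _ => coeff_eq_zero_of_mem_span_monomial hG (hF ▸ hx)) a (hG b b.2)]
          rfl
        rw [hax]
        exact Submodule.smul_mem _ _ ih
    have htop : Submodule.span K (F.image ψ : Set (G → K)) = ⊤ := by
      rw [eq_top_iff, ← (Pi.basisFun K G).span_eq, Submodule.span_le]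
      rintro _ ⟨a, rfl⟩
      have ha := hmem (monomial a 1) (hF ▸ Ideal.subset_span ⟨a, a.2, rfl⟩)
      have heq : ψ (monomial a 1) = Pi.basisFun K G a := by
        ext b
        simp [hψ, coeff_monomial, Pi.single_apply, Subtype.ext_iff, eq_comm]
      rwa [← heq]
    calc G.ncard = Module.finrank K (G → K) := by
          rw [Module.finrank_fintype_fun_eq_card, Set.ncard_eq_toFinset_card', Set.toFinset_card]
      _ = Module.finrank K (Submodule.span K (F.image ψ : Set (G → K))) := by
          rw [htop, finrank_top]
      _ ≤ (F.image ψ).card := finrank_span_finset_le_card _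
      _ ≤ F.card := Finset.card_image_le

/-- A lexsegment ideal generated in degree `d` is spanned by its monomials of degree `d`, which
form a lexsegment set. -/
lemma IsLexsegment.exists_isLexSet {d : ℕ} {I : Ideal (MvPolynomial (Fin n) K)}
    (hlex : IsLexsegment I) (hgen : GenBy I fun a => edeg a = d) :
    ∃ L, IsLexSet d L ∧ I = Ideal.span ((fun a => monomial a (1 : K)) '' L) := by
  refine ⟨{a | a ∈ expSet I ∧ edeg a = d}, ⟨fun a ha => ha.2, fun a ha b hb hba =>
    ⟨hlex.2 a b ha.1 (hb.trans ha.2.symm) hba, hb⟩⟩, le_antisymm ?_ ?_⟩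
  · obtain ⟨G, hG, hI⟩ := hgen
    have hle : (fun a => monomial a (1 : K)) '' G ⊆ I :=
      hI ▸ Ideal.subset_span
    nth_rewrite 1 [hI]
    exact Ideal.span_mono (Set.image_mono fun a ha => ⟨hle ⟨a, ha, rfl⟩, hG a ha⟩)
  · rw [Ideal.span_le]
    rintro _ ⟨a, ha, rfl⟩
    exact ha.1

lemma span_monomial_image_add (s : Fin n →₀ ℕ) (G : Set (Fin n →₀ ℕ)) :
    Ideal.span ((fun a => monomial a (1 : K)) '' ((· + s) '' G)) =
      Ideal.span {monomial s (1 : K)} * Ideal.span ((fun a => monomial a (1 : K)) '' G) := by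
  rw [Ideal.span_mul_span', Set.singleton_mul, Set.image_image, Set.image_image]
  simp [monomial_mul, add_comm]

end Generators

section MonomialMultiple

variable {K : Type} [Field K] {n : ℕ}

lemma isHomogeneous_iff_edeg {p : MvPolynomial (Fin n) K} {m : ℕ} :
    p.IsHomogeneous m ↔ ∀ e, coeff e p ≠ 0 → edeg e = m := by
  simp only [IsHomogeneous, IsWeightedHomogeneous, edeg_eq_degree, Finsupp.degree_eq_weight_one]
  rfl

lemma isHomogeneous_of_monomial_mul {s : Fin n →₀ ℕ} {q : MvPolynomial (Fin n) K} {m : ℕ}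
    (h : (monomial s (1 : K) * q).IsHomogeneous m) (hq : q ≠ 0) :
    ∃ k, m = k + edeg s ∧ q.IsHomogeneous k := by
  rw [isHomogeneous_iff_edeg] at h
  have key : ∀ e, coeff e q ≠ 0 → edeg e + edeg s = m := fun e he => by
    rw [← h (s + e) (by simpa [coeff_monomial_mul] using he), edeg_add, add_comm]
  obtain ⟨e, he⟩ := ne_zero_iff.1 hq
  exact ⟨edeg e, (key e he).symm, isHomogeneous_iff_edeg.2 fun f hf =>
    Nat.add_right_cancel ((key f hf).trans (key e he).symm)⟩

lemma monomial_mul_injective (s : Fin n →₀ ℕ) :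
    Function.Injective (LinearMap.mulLeft K (monomial s (1 : K))) :=
  mul_right_injective₀ (by simp)

lemma isHomogeneous_monomial_edeg (s : Fin n →₀ ℕ) :
    (monomial s (1 : K)).IsHomogeneous (edeg s) :=
  isHomogeneous_monomial _ (edeg_eq_degree s).symm

variable (s : Fin n →₀ ℕ) (I : Ideal (MvPolynomial (Fin n) K))

lemma hilb_monomial_mul (j : ℕ) :
    hilb (Ideal.span {monomial s (1 : K)} * I) (j + edeg s) = hilb I j := by
  have : (Submodule.restrictScalars K (Ideal.span {monomial s (1 : K)} * I)) ⊓
      homogeneousSubmodule (Fin n) K (j + edeg s) =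
      ((Submodule.restrictScalars K I) ⊓ homogeneousSubmodule (Fin n) K j).map
        (LinearMap.mulLeft K (monomial s (1 : K))) := by
    ext p
    simp only [Submodule.mem_inf, Submodule.restrictScalars_mem, Submodule.mem_map,
      Ideal.mem_span_singleton_mul, mem_homogeneousSubmodule, LinearMap.mulLeft_apply]
    constructor
    · rintro ⟨⟨q, hq, rfl⟩, hp⟩
      refine ⟨q, ⟨hq, ?_⟩, rfl⟩
      rcases eq_or_ne q 0 with rfl | hq0
      · exact isHomogeneous_zero _ _ _
      · obtain ⟨k, hk, hqk⟩ := isHomogeneous_of_monomial_mul hp hq0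
        rwa [Nat.add_right_cancel hk]
    · rintro ⟨q, ⟨hq, hqj⟩, rfl⟩
      exact ⟨⟨q, hq, rfl⟩, add_comm (edeg s) j ▸ (isHomogeneous_monomial_edeg s).mul hqj⟩
  rw [hilb, hilb, this]
  exact (Submodule.equivMapOfInjective _ (monomial_mul_injective s) _).finrank_eq.symm

lemma hilb_monomial_mul_of_lt {j : ℕ} (hj : j < edeg s) :
    hilb (Ideal.span {monomial s (1 : K)} * I) j = 0 := by
  have : (Submodule.restrictScalars K (Ideal.span {monomial s (1 : K)} * I)) ⊓
      homogeneousSubmodule (Fin n) K j = ⊥ := by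
    rw [eq_bot_iff]
    rintro p ⟨hpI, hp⟩
    obtain ⟨q, -, rfl⟩ := Ideal.mem_span_singleton_mul.1 hpI
    by_contra hne
    obtain ⟨k, hk, -⟩ := isHomogeneous_of_monomial_mul
      ((mem_homogeneousSubmodule _ _).1 hp) (by rintro rfl; simp at hne)
    omega
  rw [hilb, this, finrank_bot]

lemma hilbZ_monomial_mul (j : ℤ) :
    hilbZ (Ideal.span {monomial s (1 : K)} * I) j = hilbZ I (j - edeg s) := by
  unfold hilbZ
  split_ifs with h1 h2 h2
  · rw [← hilb_monomial_mul s I]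
    congr 1
    omega
  · exact hilb_monomial_mul_of_lt s I (by omega)
  · omega
  · rfl

lemma hilbertDecomp1_monomial_mul (k : ℕ) :
    HilbertDecomp1 (Ideal.span {monomial s (1 : K)} * I) k ↔ HilbertDecomp1 I k := by
  constructor
  · rintro ⟨ι, hι, dd, t, hk, h⟩
    refine ⟨ι, hι, dd, fun i => t i - edeg s, hk, fun j => ?_⟩
    have := h (j + edeg s)
    rw [hilbZ_monomial_mul, add_sub_cancel_right] at this
    simp [this, sub_sub_eq_add_sub]
  · rintro ⟨ι, hι, dd, t, hk, h⟩
    refine ⟨ι, hι, dd, fun i => t i + edeg s, hk, fun j => ?_⟩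
    rw [hilbZ_monomial_mul, h]
    simp [sub_sub, add_comm]

lemma expSet_monomial_mul :
    expSet (Ideal.span {monomial s (1 : K)} * I) = (· + s) '' expSet I := by
  ext a
  simp only [expSet, Set.mem_ofPred_eq, Set.mem_image, Ideal.mem_span_singleton_mul]
  constructor
  · rintro ⟨q, hq, hqa⟩
    have hs : s ≤ a := by
      by_contra hs
      have := congrArg (coeff a) hqa
      simp [coeff_monomial_mul', hs] at this
    obtain ⟨b, rfl⟩ := exists_add_of_le hs
    refine ⟨b, ?_, add_comm _ _⟩
    have hq' : q = monomial b 1 := monomial_mul_injective s (by simpa [monomial_mul] using hqa)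
    rwa [← hq']
  · rintro ⟨b, hb, rfl⟩
    exact ⟨_, hb, by simp [monomial_mul, add_comm]⟩

lemma stSpace_mul (B : Finset (MvPolynomial (Fin n) K)) (p x : MvPolynomial (Fin n) K) :
    stSpace B (p * x) = (stSpace B x).map (LinearMap.mulLeft K p) := by
  rw [stSpace, stSpace, ← Submodule.map_comp, LinearMap.mulLeft_mul]

lemma restrictScalars_monomial_mul :
    Submodule.restrictScalars K (Ideal.span {monomial s (1 : K)} * I) =
      (Submodule.restrictScalars K I).map (LinearMap.mulLeft K (monomial s (1 : K))) := by
  ext p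
  rw [Submodule.restrictScalars_mem, Ideal.mem_span_singleton_mul]
  rfl

lemma iSup_stSpace_monomial_mul_iff {ι : Type} (B : ι → Finset (MvPolynomial (Fin n) K))
    (x : ι → MvPolynomial (Fin n) K) :
    iSup (fun i => stSpace (B i) (monomial s (1 : K) * x i)) =
        Submodule.restrictScalars K (Ideal.span {monomial s (1 : K)} * I) ↔
      iSup (fun i => stSpace (B i) (x i)) = Submodule.restrictScalars K I := by
  simp only [stSpace_mul, restrictScalars_monomial_mul, ← Submodule.map_iSup]
  exact (Submodule.map_injective_of_injective (monomial_mul_injective s)).eq_iff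

lemma iSupIndep_stSpace_monomial_mul_iff {ι : Type} (B : ι → Finset (MvPolynomial (Fin n) K))
    (x : ι → MvPolynomial (Fin n) K) :
    iSupIndep (fun i => stSpace (B i) (monomial s (1 : K) * x i)) ↔
      iSupIndep fun i => stSpace (B i) (x i) := by
  simp only [stSpace_mul, iSupIndep_def, disjoint_iff, ← Submodule.map_iSup,
    ← Submodule.map_inf _ (monomial_mul_injective s),
    (Submodule.map_injective_of_injective (monomial_mul_injective s)).eq_iff' (Submodule.map_bot _)]

lemma stanleyDecomp1_monomial_mul (k : ℕ) :
    StanleyDecomp1 (Ideal.span {monomial s (1 : K)} * I) k ↔ StanleyDecomp1 I k := by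
  have hs : monomial s (1 : K) ≠ 0 := by simp
  constructor
  · rintro ⟨ι, hι, B, x, d, hB, hlin, hk, hxI, hxd, hann, hsup, hind⟩
    choose y hyI hy using fun i => Ideal.mem_span_singleton_mul.1 (hxI i)
    obtain rfl : (fun i => monomial s (1 : K) * y i) = x := funext hy
    have hy0 : ∀ i, y i ≠ 0 := fun i h0 => one_ne_zero (hann i 1 (one_mem _) (by simp [h0]))
    choose e _ hye using fun i =>
      isHomogeneous_of_monomial_mul ((mem_homogeneousSubmodule _ _).1 (hxd i)) (hy0 i)
    refine ⟨ι, hι, B, y, e, hB, hlin, hk, hyI, fun i => (mem_homogeneousSubmodule _ _).2 (hye i),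
      fun i a _ h => (mul_eq_zero.1 h).resolve_right (hy0 i),
      (iSup_stSpace_monomial_mul_iff s I B y).1 hsup,
      (iSupIndep_stSpace_monomial_mul_iff s B y).1 hind⟩
  · rintro ⟨ι, hι, B, x, d, hB, hlin, hk, hxI, hxd, hann, hsup, hind⟩
    refine ⟨ι, hι, B, fun i => monomial s (1 : K) * x i, fun i => edeg s + d i, hB, hlin, hk,
      fun i => Ideal.mem_span_singleton_mul.2 ⟨_, hxI i, rfl⟩,
      fun i => (mem_homogeneousSubmodule _ _).2 ((isHomogeneous_monomial_edeg s).mul (hxd i)),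
      fun i a ha h => hann i a ha ?_,
      (iSup_stSpace_monomial_mul_iff s I B x).2 hsup,
      (iSupIndep_stSpace_monomial_mul_iff s B x).2 hind⟩
    rw [mul_left_comm] at h
    exact (mul_eq_zero.1 h).resolve_left hs

end MonomialMultiple

section MultigradedPartitions

variable {n : ℕ}

lemma mem_cone_self (u : Fin n →₀ ℕ) (Z : Finset (Fin n)) : u ∈ cone u Z :=
  ⟨fun _ => le_rfl, fun _ _ => rfl⟩

lemma cone_add (u s : Fin n →₀ ℕ) (Z : Finset (Fin n)) :
    cone (u + s) Z = (· + s) '' cone u Z := by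
  ext a
  constructor
  · rintro ⟨h1, h2⟩
    obtain ⟨b, rfl⟩ := exists_add_of_le ((le_add_self : s ≤ u + s).trans h1)
    refine ⟨b, ⟨fun j => ?_, fun j hj => ?_⟩, add_comm _ _⟩
    · have := h1 j
      simp only [Finsupp.add_apply] at this
      omega
    · have := h2 j hj
      simp only [Finsupp.add_apply] at this
      omega
  · rintro ⟨b, ⟨h1, h2⟩, rfl⟩
    exact ⟨fun j => by simpa using h1 j, fun j hj => by simpa using h2 j hj⟩

lemma stanleyPartN_image_add (s : Fin n →₀ ℕ) (A : Set (Fin n →₀ ℕ)) (k : ℕ) :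
    StanleyPartN ((· + s) '' A) k ↔ StanleyPartN A k := by
  have hinj : Function.Injective fun a : Fin n →₀ ℕ => a + s := add_left_injective s
  constructor
  · rintro ⟨ι, hι, u, Z, hk, hsub, hA⟩
    choose v _ hv using fun i => hsub i (mem_cone_self (u i) (Z i))
    obtain rfl : (fun i => v i + s) = u := funext hv
    refine ⟨ι, hι, v, Z, hk, fun i => ?_, fun a ha => ?_⟩
    · simpa only [cone_add, Set.image_subset_image_iff hinj] using hsub i
    · simpa only [cone_add, hinj.mem_set_image] using hA (a + s) ⟨a, ha, rfl⟩
  · rintro ⟨ι, hι, u, Z, hk, hsub, hA⟩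
    refine ⟨ι, hι, fun i => u i + s, Z, hk, fun i => ?_, ?_⟩
    · simpa only [cone_add, Set.image_subset_image_iff hinj] using hsub i
    · rintro _ ⟨a, ha, rfl⟩
      simpa only [cone_add, hinj.mem_set_image] using hA a ha

lemma hilbertDecompN_iff_stanleyPartN {K : Type} [Field K]
    (I : Ideal (MvPolynomial (Fin n) K)) (k : ℕ) :
    HilbertDecompN I k ↔ StanleyPartN (expSet I) k := by
  constructor
  · rintro ⟨ι, hι, u, Z, hk, h⟩
    refine ⟨ι, hι, u, Z, hk, fun i a ha => (h a).1.2 ⟨i, ha⟩, fun a ha => ?_⟩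
    obtain ⟨i, hi⟩ := (h a).1.1 ha
    exact ⟨i, hi, fun i' hi' => (h a).2 i' i hi' hi⟩
  · rintro ⟨ι, hι, u, Z, hk, hsub, hA⟩
    exact ⟨ι, hι, u, Z, hk, fun a => ⟨⟨fun ha => (hA a ha).exists, fun ⟨i, hi⟩ => hsub i hi⟩,
      fun i i' hi hi' => (hA a (hsub i hi)).unique hi hi'⟩⟩

end MultigradedPartitions

/-- Corollary `lex_ideals`(d),(e). Suppose `I` and `I'` are lexsegment
ideals of `S = K[x_1,…,x_n]` generated by monomials of degree `d` and `d'` respectively,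
with `μ(I) = μ(I')` and `d' ≥ d`. Then `hdepth_1(I) = hdepth_1(I')`,
`hdepth_n(I) = hdepth_n(I')`, `sdepth_1(I) = sdepth_1(I')`, and `sdepth_n(I) = sdepth_n(I')`. -/
theorem lexsegment_depths_shift {K : Type} [Field K] {n d d' : ℕ}
    (I I' : Ideal (MvPolynomial (Fin n) K))
    (hlex : IsLexsegment I) (hlex' : IsLexsegment I')
    (hgen : GenBy I (fun a => edeg a = d)) (hgen' : GenBy I' (fun a => edeg a = d'))
    (hmu : mu I = mu I') (hdd : d ≤ d') :
    hdepth1 I = hdepth1 I' ∧ hdepthN I = hdepthN I' ∧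
    sdepth1 I = sdepth1 I' ∧ sdepthN (expSet I) = sdepthN (expSet I') := by
  obtain ⟨L, hL, hI⟩ := hlex.exists_isLexSet hgen
  obtain ⟨L', hL', hI'⟩ := hlex'.exists_isLexSet hgen'
  have hcard : L.ncard = L'.ncard := by
    rw [← mu_span_monomial (K := K) hL.1, ← mu_span_monomial (K := K) hL'.1, ← hI, ← hI', hmu]
  obtain ⟨s, rfl⟩ := hL.exists_eq_image_add hL' hdd hcard
  obtain rfl : I' = Ideal.span {monomial s (1 : K)} * I := by
    rw [hI', span_monomial_image_add, ← hI]
  refine ⟨?_, ?_, ?_, ?_⟩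
  · simp only [hdepth1, hilbertDecomp1_monomial_mul]
  · simp only [hdepthN, hilbertDecompN_iff_stanleyPartN, expSet_monomial_mul,
      stanleyPartN_image_add]
  · simp only [sdepth1, stanleyDecomp1_monomial_mul]
  · simp only [sdepthN, expSet_monomial_mul, stanleyPartN_image_add]
end
end
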